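/- arXiv:1712.07421 — 7 statements merged into one kernel-verified Lean document; each statement's English description precedes it below -/
import Mathlib

section
/- Let m ≥ 2 be even. If the matching M' ∈ M_m is obtained from M ∈ M_m by a centered flip, then w(M') − w(M) ∈ {m−2, −(m−2)}. -/
/-! Rainbow cycles in the flip graph of non-crossing perfect matchings on `2m`
points in convex position, labeled by the elements of `ZMod (2m)` in clockwise
cyclic order. -/

/-- `x` lies on the arc strictly between `a` and `b` (going in the direction of
increasing labels) in the cyclic order on `ZMod n`. -/
def StrictBtw (n : ℕ) (a x b : ZMod n) : Prop :=
  0 < (x - a).val ∧ (x - a).val < (b - a).val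

/-- Two unordered pairs of points cross: all four points are distinct and
exactly one endpoint of the second pair lies on each of the two arcs strictly
between the endpoints of the first pair. -/
def Crosses (n : ℕ) (e f : Sym2 (ZMod n)) : Prop :=
  ∃ a b c d : ZMod n, e = s(a, b) ∧ f = s(c, d) ∧
    a ≠ b ∧ a ≠ c ∧ a ≠ d ∧ b ≠ c ∧ b ≠ d ∧ c ≠ d ∧
    StrictBtw n a c b ∧ StrictBtw n b d a

/-- A possible matching edge on `2m` points: an unordered pair of points with
odd difference (so that an even number of points lies on either side). -/
def IsMEdge (m : ℕ) (e : Sym2 (ZMod (2 * m))) : Prop :=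
  ∃ i j : ZMod (2 * m), e = s(i, j) ∧ Odd (j - i).val

/-- A non-crossing perfect matching on the `2m` points: a set of matching
edges covering every point exactly once, no two of which cross. -/
def IsNCMatching (m : ℕ) (M : Finset (Sym2 (ZMod (2 * m)))) : Prop :=
  (∀ e ∈ M, IsMEdge m e) ∧
  (∀ p : ZMod (2 * m), ∃! e, e ∈ M ∧ p ∈ e) ∧
  (∀ e ∈ M, ∀ f ∈ M, ¬ Crosses (2 * m) e f)

/-- An `r`-rainbow cycle of length `L` in the flip graph `G_m^M` of
non-crossing perfect matchings, encoded as an `L`-periodic sequence `V` of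
matchings: consecutive matchings differ in a flip (`|M \ M'| = 2`, i.e. two
edges of `M` are replaced by the two other edges on the same four points, and
those two entering edges are the labels of the arc), no matching is visited
twice within a period, and every possible matching edge appears among the arc
labels (i.e. enters the matching) exactly `r` times per period. -/
def IsRainbowCycleM (m r L : ℕ) (V : ℕ → Finset (Sym2 (ZMod (2 * m)))) : Prop :=
  0 < L ∧
  (∀ i, V (i + L) = V i) ∧
  (∀ i < L, ∀ j < L, V i = V j → i = j) ∧
  (∀ i, IsNCMatching m (V i)) ∧
  (∀ i, (V i \ V (i + 1)).card = 2) ∧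
  (∀ g : Sym2 (ZMod (2 * m)), IsMEdge m g →
    ((Finset.range L).filter (fun i => g ∈ V (i + 1) ∧ g ∉ V i)).card = r)


/-- The length of a matching edge `{i, j}`: the minimum number of matching
edges that can lie on either of its two sides. -/
def edgeLen (m : ℕ) : Sym2 (ZMod (2 * m)) → ℕ :=
  Sym2.lift ⟨fun i j => min (((j - i).val - 1) / 2) (((i - j).val - 1) / 2),
    fun i j => min_comm _ _⟩

open Classical in
/-- The sign of a matching edge: `+1` if the endpoint `i` of the edge for
which the residue `(j - i) mod 2m` lies strictly between `0` and `m` is odd,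
and `-1` if that endpoint is even. -/
noncomputable def edgeSign (m : ℕ) (e : Sym2 (ZMod (2 * m))) : ℤ :=
  if ∃ i j : ZMod (2 * m), e = s(i, j) ∧
      0 < (j - i).val ∧ (j - i).val < m ∧ Odd i.val
  then 1 else -1

/-- The weight of a matching: the sum of the signed lengths of its edges. -/
noncomputable def weight (m : ℕ) (M : Finset (Sym2 (ZMod (2 * m)))) : ℤ :=
  ∑ e ∈ M, edgeSign m e * (edgeLen m e : ℤ)

/-- A centered flip between two non-crossing perfect matchings: `M'` is
obtained from `M` by a flip (`|M \ M'| = 2`), and the four edges involved in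
the flip have total length `m - 2` (the maximum possible value). -/
def IsCenteredFlip (m : ℕ) (M M' : Finset (Sym2 (ZMod (2 * m)))) : Prop :=
  IsNCMatching m M ∧ IsNCMatching m M' ∧ (M \ M').card = 2 ∧
  ∑ e ∈ (M \ M') ∪ (M' \ M), edgeLen m e = m - 2

lemma ZMod.val_natCast_sub_natCast_of_le {n a b : ℕ} (hab : a ≤ b) (hb : b < n) :
    ((b : ZMod n) - a).val = b - a := by
  rw [← Nat.cast_sub hab, ZMod.val_natCast_of_lt (by omega)]

lemma ZMod.val_natCast_sub_natCast_of_lt {n a b : ℕ} (hab : a < b) (hb : b < n) :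
    ((a : ZMod n) - b).val = n - (b - a) := by
  have h : (a : ZMod n) - b = ((n - (b - a) : ℕ) : ZMod n) := by
    rw [Nat.cast_sub (by omega), Nat.cast_sub hab.le, ZMod.natCast_self]
    ring
  rw [h, ZMod.val_natCast_of_lt (by omega)]

lemma ZMod.natCast_injOn_Iio (n : ℕ) : Set.InjOn (Nat.cast : ℕ → ZMod n) (Set.Iio n) := by
  intro a ha b hb h
  simpa [ZMod.val_natCast_of_lt ha, ZMod.val_natCast_of_lt hb] using congrArg ZMod.val h

lemma edgeLen_natCast {m a b : ℕ} (hab : a < b) (hb : b < 2 * m) :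
    edgeLen m s((a : ZMod (2 * m)), (b : ZMod (2 * m))) =
      min ((b - a - 1) / 2) ((2 * m - (b - a) - 1) / 2) := by
  simp [edgeLen, ZMod.val_natCast_sub_natCast_of_le hab.le hb,
    ZMod.val_natCast_sub_natCast_of_lt hab hb]

lemma edgeSign_natCast {m a b : ℕ} (hab : a < b) (hb : b < 2 * m) :
    edgeSign m s((a : ZMod (2 * m)), (b : ZMod (2 * m))) =
      if (b - a < m ∧ Odd a) ∨ (m < b - a ∧ Odd b) then 1 else -1 := by
  have h : (∃ i j : ZMod (2 * m), s((a : ZMod (2 * m)), (b : ZMod (2 * m))) = s(i, j) ∧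
      0 < (j - i).val ∧ (j - i).val < m ∧ Odd i.val) ↔
      (b - a < m ∧ Odd a) ∨ (m < b - a ∧ Odd b) := by
    have hab' := ZMod.val_natCast_sub_natCast_of_le hab.le hb
    have hba' := ZMod.val_natCast_sub_natCast_of_lt hab hb
    have ha' := ZMod.val_natCast_of_lt (hab.trans hb)
    have hb' := ZMod.val_natCast_of_lt hb
    constructor
    · rintro ⟨i, j, hij, hpos, hlt, hodd⟩
      rcases Sym2.eq_iff.mp hij with ⟨rfl, rfl⟩ | ⟨rfl, rfl⟩
      · exact Or.inl ⟨by omega, by rwa [ha'] at hodd⟩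
      · exact Or.inr ⟨by omega, by rwa [hb'] at hodd⟩
    · rintro (⟨hlt, hodd⟩ | ⟨hlt, hodd⟩)
      · exact ⟨a, b, rfl, by omega, by omega, by rwa [ha']⟩
      · exact ⟨b, a, Sym2.eq_swap, by omega, by omega, by rwa [hb']⟩
  simp only [edgeSign, h]

lemma IsMEdge.odd_sub {m a b : ℕ} (hab : a < b) (hb : b < 2 * m)
    (h : IsMEdge m s((a : ZMod (2 * m)), (b : ZMod (2 * m)))) : Odd (b - a) := by
  obtain ⟨i, j, hij, hodd⟩ := h
  rcases Sym2.eq_iff.mp hij with ⟨rfl, rfl⟩ | ⟨rfl, rfl⟩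
  · rwa [ZMod.val_natCast_sub_natCast_of_le hab.le hb] at hodd
  · rw [ZMod.val_natCast_sub_natCast_of_lt hab hb] at hodd
    grind

lemma IsMEdge.not_isDiag {m : ℕ} {e : Sym2 (ZMod (2 * m))} (h : IsMEdge m e) : ¬ e.IsDiag := by
  obtain ⟨i, j, rfl, hodd⟩ := h
  intro hij
  rw [Sym2.mk_isDiag_iff] at hij
  simp [hij] at hodd

lemma crosses_natCast {n a b c d : ℕ} (hab : a < b) (hbc : b < c) (hcd : c < d) (hd : d < n) :
    Crosses n s((a : ZMod n), (c : ZMod n)) s((b : ZMod n), (d : ZMod n)) := by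
  have hne {x y : ℕ} (hxy : x < y) (hy : y < n) : (x : ZMod n) ≠ y := fun h =>
    hxy.ne (ZMod.natCast_injOn_Iio n (hxy.trans hy) hy h)
  refine ⟨a, c, b, d, rfl, rfl, hne (by omega) (by omega), hne (by omega) (by omega),
    hne (by omega) (by omega), (hne (by omega) (by omega)).symm, hne (by omega) (by omega),
    hne (by omega) (by omega), ?_, ?_⟩
  · rw [StrictBtw, ZMod.val_natCast_sub_natCast_of_le (by omega) (by omega),
      ZMod.val_natCast_sub_natCast_of_le (by omega) (by omega)]
    omega
  · rw [StrictBtw, ZMod.val_natCast_sub_natCast_of_le (by omega) (by omega),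
      ZMod.val_natCast_sub_natCast_of_lt (by omega) (by omega)]
    omega

namespace IsNCMatching

variable {m : ℕ} {M M' : Finset (Sym2 (ZMod (2 * m)))}

lemma eq_of_mem (hM : IsNCMatching m M) {e f : Sym2 (ZMod (2 * m))} {x : ZMod (2 * m)}
    (he : e ∈ M) (hf : f ∈ M) (hxe : x ∈ e) (hxf : x ∈ f) : e = f :=
  (hM.2.1 x).unique ⟨he, hxe⟩ ⟨hf, hxf⟩

lemma exists_mem_sdiff_comm (hM : IsNCMatching m M) (hM' : IsNCMatching m M')
    (x : ZMod (2 * m)) : (∃ e ∈ M \ M', x ∈ e) ↔ ∃ e ∈ M' \ M, x ∈ e := by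
  suffices H : ∀ {N N' : Finset (Sym2 (ZMod (2 * m)))}, IsNCMatching m N → IsNCMatching m N' →
      (∃ e ∈ N \ N', x ∈ e) → ∃ e ∈ N' \ N, x ∈ e from ⟨H hM hM', H hM' hM⟩
  rintro N N' hN hN' ⟨e, he, hxe⟩
  rw [Finset.mem_sdiff] at he
  obtain ⟨f, ⟨hf, hxf⟩, -⟩ := hN'.2.1 x
  refine ⟨f, Finset.mem_sdiff.mpr ⟨hf, fun hfN => he.2 ?_⟩, hxf⟩
  rwa [hN.eq_of_mem he.1 hfN hxe hxf]

/-- Two edges of a non-crossing perfect matching cover exactly four points. -/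
lemma exists_strictMono_of_card_eq_two [NeZero m] (hM : IsNCMatching m M)
    {A : Finset (Sym2 (ZMod (2 * m)))} (hA : A ⊆ M) (hcard : A.card = 2) :
    ∃ p : Fin 4 → ℕ, StrictMono p ∧ (∀ i, p i < 2 * m) ∧
      ∀ x : ZMod (2 * m), (∃ e ∈ A, x ∈ e) ↔ ∃ i, x = p i := by
  obtain ⟨e, f, hef, rfl⟩ := Finset.card_eq_two.mp hcard
  have he : e ∈ M := hA (by simp)
  have hf : f ∈ M := hA (by simp)
  have hde := (hM.1 e he).not_isDiag
  have hdf := (hM.1 f hf).not_isDiag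
  have hdisj : ∀ x, x ∈ e → x ∉ f := fun x hxe hxf => hef (hM.eq_of_mem he hf hxe hxf)
  have hS : (e.toFinset ∪ f.toFinset).card = 4 := by
    rw [Finset.card_union_of_disjoint, Sym2.card_toFinset_of_not_isDiag _ hde,
      Sym2.card_toFinset_of_not_isDiag _ hdf]
    rw [Finset.disjoint_left]
    simpa using hdisj
  have hS' : ((e.toFinset ∪ f.toFinset).image ZMod.val).card = 4 := by
    rw [Finset.card_image_of_injective _ (ZMod.val_injective _), hS]
  refine ⟨_, (Finset.orderEmbOfFin _ hS').strictMono, fun i => ?_, fun x => ?_⟩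
  · obtain ⟨y, -, hy⟩ := Finset.mem_image.mp (Finset.orderEmbOfFin_mem _ hS' i)
    rw [← hy]
    exact y.val_lt
  · have hmem : (∃ g ∈ ({e, f} : Finset (Sym2 (ZMod (2 * m)))), x ∈ g) ↔
        x ∈ e.toFinset ∪ f.toFinset := by simp
    rw [hmem]
    constructor
    · intro hx
      have hx' : x.val ∈ Set.range (Finset.orderEmbOfFin _ hS') := by
        rw [Finset.range_orderEmbOfFin]
        exact Finset.mem_coe.mpr (Finset.mem_image_of_mem _ hx)
      obtain ⟨i, hi⟩ := hx'
      exact ⟨i, by rw [hi, ZMod.natCast_zmod_val]⟩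
    · rintro ⟨i, rfl⟩
      obtain ⟨y, hy, hyi⟩ := Finset.mem_image.mp (Finset.orderEmbOfFin_mem _ hS' i)
      rwa [← hyi, ZMod.natCast_zmod_val]

/-- The edges of a non-crossing matching that cover exactly four given points form one of the two
non-crossing matchings of these points. -/
lemma eq_pair_or_eq_pair (hM : IsNCMatching m M) {A : Finset (Sym2 (ZMod (2 * m)))} (hA : A ⊆ M)
    {p : Fin 4 → ℕ} (hp : StrictMono p) (hlt : ∀ i, p i < 2 * m)
    (hcov : ∀ x : ZMod (2 * m), (∃ e ∈ A, x ∈ e) ↔ ∃ i, x = p i) :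
    A = {s((p 0 : ZMod (2 * m)), (p 1 : ZMod (2 * m))), s((p 2 : ZMod (2 * m)), (p 3 : ZMod (2 * m)))} ∨
    A = {s((p 1 : ZMod (2 * m)), (p 2 : ZMod (2 * m))), s((p 0 : ZMod (2 * m)), (p 3 : ZMod (2 * m)))} := by
  have hinj : ∀ i j, (p i : ZMod (2 * m)) = p j → i = j := fun i j h =>
    hp.injective (ZMod.natCast_injOn_Iio _ (hlt i) (hlt j) h)
  have hpartner : ∀ i, ∃ j, j ≠ i ∧ s((p i : ZMod (2 * m)), (p j : ZMod (2 * m))) ∈ A := by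
    intro i
    obtain ⟨e, he, hie⟩ := (hcov (p i)).mpr ⟨i, rfl⟩
    obtain ⟨y, rfl⟩ := Sym2.mem_iff_exists.mp hie
    obtain ⟨j, rfl⟩ := (hcov y).mp ⟨_, he, Sym2.mem_mk_right _ _⟩
    refine ⟨j, ?_, he⟩
    rintro rfl
    exact (hM.1 _ (hA he)).not_isDiag (by simp)
  have huniq : ∀ i j k, s((p i : ZMod (2 * m)), (p j : ZMod (2 * m))) ∈ A →
      s((p i : ZMod (2 * m)), (p k : ZMod (2 * m))) ∈ A → j = k := by
    intro i j k hj hk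
    have h := hM.eq_of_mem (hA hj) (hA hk) (Sym2.mem_mk_left _ _) (Sym2.mem_mk_left _ _)
    exact hinj _ _ (Sym2.congr_right.mp h)
  have hpair : ∀ i j k l, s((p i : ZMod (2 * m)), (p j : ZMod (2 * m))) ∈ A →
      s((p k : ZMod (2 * m)), (p l : ZMod (2 * m))) ∈ A →
      (∀ t : Fin 4, t = i ∨ t = j ∨ t = k ∨ t = l) →
      A = {s((p i : ZMod (2 * m)), (p j : ZMod (2 * m))),
        s((p k : ZMod (2 * m)), (p l : ZMod (2 * m)))} := by
    intro i j k l hij hkl hall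
    refine Finset.Subset.antisymm (fun e he => ?_) (by simp [Finset.insert_subset_iff, hij, hkl])
    obtain ⟨x, hx⟩ : ∃ x, x ∈ e := ⟨_, Sym2.out_fst_mem e⟩
    obtain ⟨t, rfl⟩ := (hcov x).mp ⟨e, he, hx⟩
    rw [Finset.mem_insert, Finset.mem_singleton]
    rcases hall t with rfl | rfl | rfl | rfl
    · exact Or.inl (hM.eq_of_mem (hA he) (hA hij) hx (Sym2.mem_mk_left _ _))
    · exact Or.inl (hM.eq_of_mem (hA he) (hA hij) hx (Sym2.mem_mk_right _ _))
    · exact Or.inr (hM.eq_of_mem (hA he) (hA hkl) hx (Sym2.mem_mk_left _ _))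
    · exact Or.inr (hM.eq_of_mem (hA he) (hA hkl) hx (Sym2.mem_mk_right _ _))
  have hsymm : ∀ i j, s((p i : ZMod (2 * m)), (p j : ZMod (2 * m))) ∈ A →
      s((p j : ZMod (2 * m)), (p i : ZMod (2 * m))) ∈ A := fun i j h => by rwa [Sym2.eq_swap]
  have h01 : p 0 < p 1 := hp (by decide)
  have h12 : p 1 < p 2 := hp (by decide)
  have h23 : p 2 < p 3 := hp (by decide)
  obtain ⟨j, hj0, hj⟩ := hpartner 0
  obtain rfl | rfl | rfl : j = 1 ∨ j = 2 ∨ j = 3 := by omega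
  · obtain ⟨k, hk2, hk⟩ := hpartner 2
    have hk0 : k ≠ 0 := by
      rintro rfl
      exact absurd (huniq 0 1 2 hj (hsymm _ _ hk)) (by decide)
    have hk1 : k ≠ 1 := by
      rintro rfl
      exact absurd (huniq 1 0 2 (hsymm _ _ hj) (hsymm _ _ hk)) (by decide)
    obtain rfl : k = 3 := by omega
    exact Or.inl (hpair 0 1 2 3 hj hk (by decide))
  · obtain ⟨k, hk1, hk⟩ := hpartner 1
    have hk0 : k ≠ 0 := by
      rintro rfl
      exact absurd (huniq 0 2 1 hj (hsymm _ _ hk)) (by decide)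
    have hk2 : k ≠ 2 := by
      rintro rfl
      exact absurd (huniq 2 0 1 (hsymm _ _ hj) (hsymm _ _ hk)) (by decide)
    obtain rfl : k = 3 := by omega
    exact absurd (crosses_natCast h01 h12 h23 (hlt 3)) (hM.2.2 _ (hA hj) _ (hA hk))
  · obtain ⟨k, hk1, hk⟩ := hpartner 1
    have hk0 : k ≠ 0 := by
      rintro rfl
      exact absurd (huniq 0 3 1 hj (hsymm _ _ hk)) (by decide)
    have hk3 : k ≠ 3 := by
      rintro rfl
      exact absurd (huniq 3 0 1 (hsymm _ _ hj) (hsymm _ _ hk)) (by decide)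
    obtain rfl : k = 2 := by omega
    exact Or.inr (hpair 1 2 0 3 hk hj (by decide))

end IsNCMatching

lemma weight_sub_weight (m : ℕ) (M M' : Finset (Sym2 (ZMod (2 * m)))) :
    weight m M' - weight m M = weight m (M' \ M) - weight m (M \ M') := by
  unfold weight
  rw [Finset.sum_sdiff_sub_sum_sdiff]

/-- If the sides of a quadrilateral are matching edges of total length `m - 2`, then the weights of
its two pairs of opposite sides differ by `m - 2` in absolute value. -/
lemma weight_sub_weight_of_quadrilateral {m a b c d : ℕ} (hm : 2 ≤ m) (heven : Even m)
    (hab : a < b) (hbc : b < c) (hcd : c < d) (hd : d < 2 * m)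
    {X Y : Finset (Sym2 (ZMod (2 * m)))}
    (hX : X = {s((a : ZMod (2 * m)), (b : ZMod (2 * m))), s((c : ZMod (2 * m)), (d : ZMod (2 * m)))})
    (hY : Y = {s((b : ZMod (2 * m)), (c : ZMod (2 * m))), s((a : ZMod (2 * m)), (d : ZMod (2 * m)))})
    (hXY : Disjoint X Y) (hEX : ∀ e ∈ X, IsMEdge m e) (hEY : ∀ e ∈ Y, IsMEdge m e)
    (hsum : ∑ e ∈ X ∪ Y, edgeLen m e = m - 2) :
    weight m Y - weight m X = (m : ℤ) - 2 ∨ weight m Y - weight m X = -((m : ℤ) - 2) := by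
  have hne {x y : ℕ} (hxy : x < y) (hy : y < 2 * m) : (x : ZMod (2 * m)) ≠ y := fun h =>
    hxy.ne (ZMod.natCast_injOn_Iio _ (hxy.trans hy) hy h)
  have hX' : s((a : ZMod (2 * m)), (b : ZMod (2 * m))) ≠
      s((c : ZMod (2 * m)), (d : ZMod (2 * m))) := by
    rw [Ne, Sym2.eq_iff]
    rintro (⟨h, -⟩ | ⟨h, -⟩)
    · exact hne (by omega) (by omega) h
    · exact hne (by omega) (by omega) h
  have hY' : s((b : ZMod (2 * m)), (c : ZMod (2 * m))) ≠
      s((a : ZMod (2 * m)), (d : ZMod (2 * m))) := by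
    rw [Ne, Sym2.eq_iff]
    rintro (⟨h, -⟩ | ⟨h, -⟩)
    · exact hne (by omega) (by omega) h.symm
    · exact hne (by omega) (by omega) h
  subst hX hY
  have oab := (hEX _ (by simp)).odd_sub hab (by omega)
  have ocd := (hEX s((c : ZMod (2 * m)), (d : ZMod (2 * m))) (by simp)).odd_sub hcd hd
  have obc := (hEY _ (by simp)).odd_sub hbc (by omega)
  have oad := (hEY s((a : ZMod (2 * m)), (d : ZMod (2 * m))) (by simp)).odd_sub (by omega) hd
  rw [Finset.sum_union hXY, Finset.sum_pair hX', Finset.sum_pair hY'] at hsum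
  rw [weight, weight, Finset.sum_pair hX', Finset.sum_pair hY',
    edgeSign_natCast hab (by omega), edgeSign_natCast hcd hd, edgeSign_natCast hbc (by omega),
    edgeSign_natCast (show a < d by omega) hd]
  have lab := edgeLen_natCast hab (show b < 2 * m by omega)
  have lcd := edgeLen_natCast hcd hd
  have lbc := edgeLen_natCast hbc (show c < 2 * m by omega)
  have lad := edgeLen_natCast (show a < d by omega) hd
  simp only [Nat.odd_iff, Nat.even_iff] at *
  have gab : b - a < m := by omega
  have gbc : c - b < m := by omega
  have gcd : d - c < m := by omega
  have gad : m < d - a := by omega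
  simp only [gab, gbc, gcd, gad, gad.not_gt, gab.not_gt, gbc.not_gt, gcd.not_gt, true_and,
    false_and, or_false, false_or]
  rcases (Nat.mod_two_eq_zero_or_one a).symm with ha | ha
  · rw [if_neg (by omega), if_neg (by omega), if_pos (by omega), if_pos (by omega)]
    omega
  · rw [if_pos (by omega), if_pos (by omega), if_neg (by omega), if_neg (by omega)]
    omega

/-- For even `m ≥ 2`, a centered flip changes the weight of a non-crossing
perfect matching by exactly `+(m-2)` or `-(m-2)`. -/
theorem centered_flip_weight_change (m : ℕ) (hm : 2 ≤ m) (heven : Even m)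
    (M M' : Finset (Sym2 (ZMod (2 * m)))) (hflip : IsCenteredFlip m M M') :
    weight m M' - weight m M = (m : ℤ) - 2 ∨
    weight m M' - weight m M = -((m : ℤ) - 2) := by
  obtain ⟨hM, hM', hcard, hsum⟩ := hflip
  have : NeZero m := ⟨by omega⟩
  obtain ⟨p, hp, hlt, hcov⟩ := hM.exists_strictMono_of_card_eq_two Finset.sdiff_subset hcard
  have hcov' := fun x => (hM.exists_mem_sdiff_comm hM' x).symm.trans (hcov x)
  have h01 : p 0 < p 1 := hp (by decide)
  have h12 : p 1 < p 2 := hp (by decide)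
  have h23 : p 2 < p 3 := hp (by decide)
  have hdisj : Disjoint (M \ M') (M' \ M) := disjoint_sdiff_sdiff
  have hne : M \ M' ≠ M' \ M := by
    intro h
    rw [← h, disjoint_self, Finset.bot_eq_empty] at hdisj
    simp [hdisj] at hcard
  have hE : ∀ e ∈ M \ M', IsMEdge m e := fun e he => hM.1 e (Finset.sdiff_subset he)
  have hE' : ∀ e ∈ M' \ M, IsMEdge m e := fun e he => hM'.1 e (Finset.sdiff_subset he)
  rw [weight_sub_weight]
  rcases hM.eq_pair_or_eq_pair Finset.sdiff_subset hp hlt hcov with h | h <;>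
    rcases hM'.eq_pair_or_eq_pair Finset.sdiff_subset hp hlt hcov' with h' | h'
  · exact absurd (h.trans h'.symm) hne
  · exact weight_sub_weight_of_quadrilateral hm heven h01 h12 h23 (hlt 3) h h' hdisj hE hE' hsum
  · rw [Finset.union_comm] at hsum
    have := weight_sub_weight_of_quadrilateral hm heven h01 h12 h23 (hlt 3) h' h hdisj.symm
      hE' hE hsum
    omega
  · exact absurd (h.trans h'.symm) hne
end

section
/- Let m ≥ 2 be even. For every non-crossing perfect matching M ∈ M_m, the weight satisfies −(m−2) ≤ w(M) ≤ m−2; conversely, for every integer c with −(m−2) ≤ c ≤ m−2 there exists a matching M ∈ M_m with w(M) = c. -/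
section MatchingWeight

variable {m : ℕ}

/-- `F` restricts to an involution of `{0, …, 2m - 1}` pairing points of opposite parity
without crossings. -/
structure IsNCPairing (m : ℕ) (F : ℕ → ℕ) : Prop where
  lt : ∀ p < 2 * m, F p < 2 * m
  invol : ∀ p < 2 * m, F (F p) = p
  parity : ∀ p < 2 * m, p % 2 ≠ F p % 2
  noncrossing : ∀ p q, p < q → q < F p → F p < 2 * m → p < F q ∧ F q < F p

/-- The left endpoints of a pairing. -/
def leftEnds (m : ℕ) (F : ℕ → ℕ) : Finset ℕ := {p ∈ Finset.range (2 * m) | p < F p}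

theorem mem_leftEnds {F : ℕ → ℕ} {p : ℕ} : p ∈ leftEnds m F ↔ p < 2 * m ∧ p < F p := by
  simp [leftEnds]

/-- The matching edges of a pairing. -/
def pairingEdges (m : ℕ) (F : ℕ → ℕ) : Finset (Sym2 (ZMod (2 * m))) :=
  (leftEnds m F).image fun p : ℕ => s((p : ZMod (2 * m)), ((F p : ℕ) : ZMod (2 * m)))

theorem IsNCPairing.sum_leftEnds {F : ℕ → ℕ} (hF : IsNCPairing m F) (h : ℕ → ℤ) :
    ∑ p ∈ leftEnds m F, (h p + h (F p)) = ∑ p ∈ Finset.range (2 * m), h p := by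
  rw [Finset.sum_add_distrib,
    ← Finset.sum_filter_add_sum_filter_not (Finset.range (2 * m)) (fun p => p < F p) h]
  congr 1
  refine Finset.sum_nbij' F F ?_ ?_ ?_ ?_ fun _ _ => rfl
  · intro p hp
    obtain ⟨hp, hlt⟩ := mem_leftEnds.1 hp
    simp only [Finset.mem_filter, Finset.mem_range, hF.invol p hp]
    exact ⟨hF.lt p hp, by omega⟩
  · intro p hp
    simp only [Finset.mem_filter, Finset.mem_range] at hp
    have := hF.parity p hp.1
    rw [mem_leftEnds, hF.invol p hp.1]
    refine ⟨hF.lt p hp.1, ?_⟩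
    have : p ≠ F p := fun h => this (congrArg (· % 2) h)
    omega
  · exact fun p hp => hF.invol p (mem_leftEnds.1 hp).1
  · exact fun p hp => hF.invol p (Finset.mem_range.1 (Finset.mem_filter.1 hp).1)

theorem IsNCPairing.card_leftEnds {F : ℕ → ℕ} (hF : IsNCPairing m F) : (leftEnds m F).card = m := by
  have := hF.sum_leftEnds fun _ => 1
  simp at this
  omega

theorem IsNCPairing.succ_mem_leftEnds {F : ℕ → ℕ} (hF : IsNCPairing m F) {i : ℕ} (hi : i + 1 < F i)
    (hFi : F i < 2 * m) : i + 1 ∈ leftEnds m F := by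
  have h1 := hF.noncrossing i (i + 1) (by omega) hi hFi
  have h2 := hF.parity (i + 1) (by omega)
  have : i + 1 ≠ F (i + 1) := fun h => h2 (congrArg (· % 2) h)
  exact mem_leftEnds.2 ⟨by omega, by omega⟩

theorem IsNCPairing.mem_pairingEdges {F : ℕ → ℕ} (hF : IsNCPairing m F) {p : ℕ}
    (hp : p < 2 * m) : s((p : ZMod (2 * m)), ((F p : ℕ) : ZMod (2 * m))) ∈ pairingEdges m F := by
  have h1 := hF.parity p hp
  have h2 := hF.lt p hp
  have h3 := hF.invol p hp
  rcases lt_or_gt_of_ne (fun h => h1 (congrArg (· % 2) h) : p ≠ F p) with h | h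
  · exact Finset.mem_image_of_mem _ (mem_leftEnds.2 ⟨hp, h⟩)
  · exact Finset.mem_image.2 ⟨F p, mem_leftEnds.2 ⟨h2, by omega⟩, by rw [h3, Sym2.eq_swap]⟩

theorem IsNCPairing.eq_of_mk_mem {F : ℕ → ℕ} (hF : IsNCPairing m F) {a b : ZMod (2 * m)}
    (h : s(a, b) ∈ pairingEdges m F) : b.val = F a.val := by
  obtain ⟨p, hp, he⟩ := Finset.mem_image.1 h
  obtain ⟨hp, -⟩ := mem_leftEnds.1 hp
  rcases Sym2.eq_iff.1 he with ⟨rfl, rfl⟩ | ⟨rfl, rfl⟩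
  · rw [ZMod.val_cast_of_lt (hF.lt p hp), ZMod.val_cast_of_lt hp]
  · rw [ZMod.val_cast_of_lt (hF.lt p hp), ZMod.val_cast_of_lt hp, hF.invol p hp]

/-- The signed number of edges spanning more than half of the points. -/
def IsNCPairing.longSum (m : ℕ) (F : ℕ → ℕ) : ℤ :=
  ∑ p ∈ leftEnds m F, if p + m < F p then (-1) ^ p else 0

theorem IsNCPairing.longSum_eq_of_maximal {F : ℕ → ℕ} (hF : IsNCPairing m F) {i : ℕ} (hi : i + m < F i)
    (hi' : i < 2 * m) (hmax : ∀ p ∈ leftEnds m F, p + m < F p → p ≤ i) :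
    longSum m F = if Even i then 1 else 0 := by
  have hFi := hF.lt i hi'
  have hcut := hF.sum_leftEnds fun p => if p < i + 1 then (-1) ^ p else 0
  rw [← Finset.sum_filter] at hcut
  have hr : {p ∈ Finset.range (2 * m) | p < i + 1} = Finset.range (i + 1) := by
    ext p
    simp only [Finset.mem_filter, Finset.mem_range]
    omega
  rw [hr, neg_one_geom_sum] at hcut
  simp only [Nat.even_add_one] at hcut
  rw [longSum]
  convert hcut using 1
  · refine Finset.sum_congr rfl fun p hp => ?_
    have hmaxp := hmax p hp
    obtain ⟨hp, hlt⟩ := mem_leftEnds.1 hp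
    have hpar := hF.parity p hp
    have hFp := hF.lt p hp
    have hn1 := hF.noncrossing p i
    have hn2 := hF.noncrossing i (F p)
    rw [hF.invol p hp] at hn2
    rcases lt_trichotomy p i with h | rfl | h
    · by_cases h2 : F p < i + 1
      · rw [if_neg (by omega), if_pos (by omega), if_pos h2]
        rcases Nat.even_or_odd p with h | h
        · have h' : Odd (F p) := by rw [Nat.even_iff] at h; rw [Nat.odd_iff]; omega
          simp [h.neg_one_pow, h'.neg_one_pow]
        · have h' : Even (F p) := by rw [Nat.odd_iff] at h; rw [Nat.even_iff]; omega
          simp [h.neg_one_pow, h'.neg_one_pow]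
      · rw [if_pos (by omega), if_pos (by omega), if_neg h2, add_zero]
    · rw [if_pos hi, if_pos (by omega), if_neg (by omega), add_zero]
    · rw [if_neg (by omega), if_neg (by omega), if_neg (by omega), add_zero]
  · split_ifs <;> simp_all

/-- Two adjacent blocks `{0, …, 2t + 1}` and `{2t + 2, …, 2t + 2u + 3}`, each consisting of one
edge around `t`, respectively `u`, edges between neighbours, followed by edges between
neighbours. -/
def twoBlockPairing (t u p : ℕ) : ℕ :=
  if p = 0 then 2 * t + 1
  else if p < 2 * t + 1 then (if p % 2 = 1 then p + 1 else p - 1)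
  else if p = 2 * t + 1 then 0
  else if p = 2 * t + 2 then 2 * t + 2 * u + 3
  else if p < 2 * t + 2 * u + 3 then (if p % 2 = 1 then p + 1 else p - 1)
  else if p = 2 * t + 2 * u + 3 then 2 * t + 2
  else if p % 2 = 1 then p - 1 else p + 1

theorem twoBlockPairing_spec (t u p : ℕ) :
    (p = 0 ∧ twoBlockPairing t u p = 2 * t + 1) ∨
    (p = 2 * t + 1 ∧ twoBlockPairing t u p = 0) ∨
    (p = 2 * t + 2 ∧ twoBlockPairing t u p = 2 * t + 2 * u + 3) ∨
    (p = 2 * t + 2 * u + 3 ∧ twoBlockPairing t u p = 2 * t + 2) ∨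
    ((0 < p ∧ p < 2 * t + 1 ∨ 2 * t + 2 < p ∧ p < 2 * t + 2 * u + 3) ∧
      (p % 2 = 1 ∧ twoBlockPairing t u p = p + 1 ∨
        p % 2 = 0 ∧ twoBlockPairing t u p + 1 = p)) ∨
    (2 * t + 2 * u + 3 < p ∧
      (p % 2 = 0 ∧ twoBlockPairing t u p = p + 1 ∨
        p % 2 = 1 ∧ twoBlockPairing t u p + 1 = p)) := by
  unfold twoBlockPairing
  split_ifs <;> omega

theorem isNCPairing_twoBlockPairing {t u : ℕ} (h : t + u + 2 ≤ m) :
    IsNCPairing m (twoBlockPairing t u) := by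
  refine ⟨fun p hp => ?_, fun p hp => ?_, fun p hp => ?_, fun p q h1 h2 h3 => ?_⟩
  · have := twoBlockPairing_spec t u p
    omega
  · have h1 := twoBlockPairing_spec t u p
    have h2 := twoBlockPairing_spec t u (twoBlockPairing t u p)
    generalize twoBlockPairing t u (twoBlockPairing t u p) = y at *
    generalize twoBlockPairing t u p = x at *
    rcases h1 with h1 | h1 | h1 | h1 | h1 | h1 <;> omega
  · have := twoBlockPairing_spec t u p
    omega
  · have h4 := twoBlockPairing_spec t u p
    have h5 := twoBlockPairing_spec t u q
    rcases h4 with h4 | h4 | h4 | h4 | h4 | h4 <;> omega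

theorem ZMod.val_sub_eq_ite {n : ℕ} [NeZero n] (x a : ZMod n) :
    (x - a).val = if a.val ≤ x.val then x.val - a.val else x.val + n - a.val := by
  split_ifs with h
  · exact ZMod.val_sub h
  · have hax : (a - x).val = a.val - x.val := ZMod.val_sub (by omega)
    have hne : NeZero (a - x) := ⟨fun h0 => by rw [h0, ZMod.val_zero] at hax; omega⟩
    have hlt := ZMod.val_lt a
    rw [← neg_sub, ZMod.val_neg_of_ne_zero, hax]
    omega

theorem strictBtw_iff {n : ℕ} [NeZero n] (a x b : ZMod n) :
    StrictBtw n a x b ↔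
      (a.val < x.val ∧ x.val < b.val) ∨ (b.val < a.val ∧ a.val < x.val) ∨
        (x.val < b.val ∧ b.val < a.val) := by
  have ha := ZMod.val_lt a
  have hb := ZMod.val_lt b
  have hx := ZMod.val_lt x
  unfold StrictBtw
  rw [ZMod.val_sub_eq_ite, ZMod.val_sub_eq_ite]
  split_ifs <;> omega

variable [NeZero (2 * m)]

theorem isMEdge_iff (a b : ZMod (2 * m)) :
    IsMEdge m s(a, b) ↔ a.val % 2 ≠ b.val % 2 := by
  have ha := ZMod.val_lt a
  have hb := ZMod.val_lt b
  constructor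
  · rintro ⟨i, j, hij, hodd⟩
    rw [ZMod.val_sub_eq_ite, Nat.odd_iff] at hodd
    rcases Sym2.eq_iff.1 hij with ⟨rfl, rfl⟩ | ⟨rfl, rfl⟩ <;> split_ifs at hodd <;> omega
  · intro h
    refine ⟨a, b, rfl, ?_⟩
    rw [ZMod.val_sub_eq_ite, Nat.odd_iff]
    split_ifs <;> omega

theorem ZMod.val_sub_rev {n : ℕ} [NeZero n] {a b : ZMod n} (h : a ≠ b) :
    (a - b).val = n - (b - a).val := by
  have hne : NeZero (b - a) := ⟨sub_ne_zero.2 h.symm⟩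
  rw [← neg_sub, ZMod.val_neg_of_ne_zero]

theorem edgeSign_of_lt {i j : ZMod (2 * m)} (h0 : 0 < (j - i).val) (h1 : (j - i).val < m) :
    edgeSign m s(i, j) = if Odd i.val then 1 else -1 := by
  have hne : i ≠ j := by rintro rfl; simp at h0
  unfold edgeSign
  congr 1
  rw [eq_iff_iff]
  constructor
  · rintro ⟨a, b, hab, -, h3, h4⟩
    rcases Sym2.eq_iff.1 hab with ⟨rfl, rfl⟩ | ⟨rfl, rfl⟩
    · exact h4
    · rw [ZMod.val_sub_rev hne] at h3
      omega
  · exact fun h => ⟨i, j, rfl, h0, h1, h⟩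

theorem edgeLen_of_lt {i j : ZMod (2 * m)} (h0 : 0 < (j - i).val) (h1 : (j - i).val < m) :
    edgeLen m s(i, j) = ((j - i).val - 1) / 2 := by
  have hne : i ≠ j := by rintro rfl; simp at h0
  change min (((j - i).val - 1) / 2) (((i - j).val - 1) / 2) = _
  rw [ZMod.val_sub_rev hne]
  omega

theorem IsMEdge.exists_short (heven : Even m) {e : Sym2 (ZMod (2 * m))} (he : IsMEdge m e) :
    ∃ i j : ZMod (2 * m), e = s(i, j) ∧ 0 < (j - i).val ∧ (j - i).val < m := by
  obtain ⟨i, j, rfl, hodd⟩ := he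
  have hne : i ≠ j := by rintro rfl; simp at hodd
  have hm := Nat.even_iff.1 heven
  have hrev := ZMod.val_sub_rev hne
  rw [Nat.odd_iff] at hodd
  by_cases h : (j - i).val < m
  · exact ⟨i, j, rfl, by omega, h⟩
  · have := ZMod.val_lt (j - i)
    exact ⟨j, i, Sym2.eq_swap, by omega, by omega⟩

theorem odd_val_add_one_iff (i : ZMod (2 * m)) : Odd (i + 1).val ↔ ¬ Odd i.val := by
  have hi := ZMod.val_lt i
  have h1 : (i + 1).val = (i.val + 1) % (2 * m) := by
    have : ((i.val + 1 : ℕ) : ZMod (2 * m)) = i + 1 := by simp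
    rw [← this, ZMod.val_natCast]
  rw [h1, Nat.odd_iff, Nat.odd_iff, Nat.mod_mod_of_dvd _ (dvd_mul_right 2 m)]
  omega

/-- Rotating a matching by one point negates its weight. -/
theorem IsNCMatching.exists_weight_neg (heven : Even m) {M : Finset (Sym2 (ZMod (2 * m)))}
    (hM : IsNCMatching m M) : ∃ M', IsNCMatching m M' ∧ weight m M' = - weight m M := by
  classical
  obtain ⟨hE, hU, hC⟩ := hM
  have hinj : Function.Injective (fun x : ZMod (2 * m) => x + 1) := add_left_injective 1
  refine ⟨M.image (Sym2.map (· + 1)), ⟨?_, ?_, ?_⟩, ?_⟩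
  · intro e he
    obtain ⟨e, he₀, rfl⟩ := Finset.mem_image.1 he
    obtain ⟨i, j, rfl, h⟩ := hE e he₀
    exact ⟨i + 1, j + 1, rfl, by simpa using h⟩
  · intro p
    obtain ⟨e, ⟨he, hp⟩, huniq⟩ := hU (p - 1)
    refine ⟨e.map (· + 1), ⟨Finset.mem_image_of_mem _ he,
      Sym2.mem_map.2 ⟨p - 1, hp, by simp⟩⟩, ?_⟩
    rintro e' ⟨he', hp'⟩
    obtain ⟨e', he₀, rfl⟩ := Finset.mem_image.1 he'
    obtain ⟨q, hq, rfl⟩ := Sym2.mem_map.1 hp'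
    rw [huniq e' ⟨he₀, by simpa using hq⟩]
  · intro e he f hf hcross
    obtain ⟨e, he₀, rfl⟩ := Finset.mem_image.1 he
    obtain ⟨f, hf₀, rfl⟩ := Finset.mem_image.1 hf
    obtain ⟨a, b, c, d, h1, h2, h3, h4, h5, h6, h7, h8, h9, h10⟩ := hcross
    have key : ∀ g : Sym2 (ZMod (2 * m)), ∀ x y, g.map (· + 1) = s(x, y) →
        g = s(x - 1, y - 1) := by
      intro g x y hg
      apply Sym2.map.injective hinj
      simpa using hg
    refine hC e he₀ f hf₀ ⟨a - 1, b - 1, c - 1, d - 1, key _ _ _ h1, key _ _ _ h2, ?_⟩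
    simp only [StrictBtw, sub_sub_sub_cancel_right, ne_eq, sub_left_inj]
    exact ⟨h3, h4, h5, h6, h7, h8, h9, h10⟩
  · unfold weight
    rw [Finset.sum_image fun _ _ _ _ h => Sym2.map.injective hinj h, ← Finset.sum_neg_distrib]
    refine Finset.sum_congr rfl fun e he => ?_
    obtain ⟨i, j, rfl, h0, h1⟩ := (hE e he).exists_short heven
    have hd : (j + 1) - (i + 1) = j - i := by ring
    rw [Sym2.map_mk, edgeLen_of_lt h0 h1, edgeSign_of_lt h0 h1,
      edgeLen_of_lt (by rwa [hd]) (by rwa [hd]), edgeSign_of_lt (by rwa [hd]) (by rwa [hd]), hd]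
    by_cases h : Odd i.val <;> simp [odd_val_add_one_iff, h]

theorem IsNCPairing.isNCMatching {F : ℕ → ℕ} (hF : IsNCPairing m F) :
    IsNCMatching m (pairingEdges m F) := by
  refine ⟨?_, ?_, ?_⟩
  · intro e he
    induction e with | _ a b
    rw [isMEdge_iff, hF.eq_of_mk_mem he]
    exact hF.parity _ (ZMod.val_lt a)
  · intro p
    have hp := ZMod.val_lt p
    refine ⟨s(p, (F p.val : ZMod (2 * m))), ⟨?_, Sym2.mem_mk_left _ _⟩, ?_⟩
    · simpa using hF.mem_pairingEdges hp
    · rintro e ⟨he, q, rfl⟩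
      rw [← hF.eq_of_mk_mem he, ZMod.natCast_zmod_val]
  · rintro e he f hf ⟨a, b, c, d, rfl, rfl, -, -, -, -, -, -, h1, h2⟩
    rw [strictBtw_iff] at h1 h2
    have hab := hF.eq_of_mk_mem he
    have hcd := hF.eq_of_mk_mem hf
    have hba := hF.eq_of_mk_mem (Sym2.eq_swap ▸ he)
    have hdc := hF.eq_of_mk_mem (Sym2.eq_swap ▸ hf)
    have n1 := hF.noncrossing a.val c.val
    have n2 := hF.noncrossing a.val d.val
    have n3 := hF.noncrossing b.val c.val
    have n4 := hF.noncrossing b.val d.val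
    have := ZMod.val_lt a
    have := ZMod.val_lt b
    omega

theorem IsNCMatching.exists_pairing {M : Finset (Sym2 (ZMod (2 * m)))} (hM : IsNCMatching m M) :
    ∃ F, IsNCPairing m F ∧ M = pairingEdges m F := by
  obtain ⟨hE, hU, hC⟩ := hM
  have hex : ∀ p : ZMod (2 * m), ∃ q, s(p, q) ∈ M := by
    intro p
    obtain ⟨e, ⟨he, q, rfl⟩, -⟩ := hU p
    exact ⟨q, he⟩
  choose g hg using hex
  have huniq : ∀ p q, s(p, q) ∈ M → q = g p := fun p q h =>
    Sym2.congr_right.1 ((hU p).unique ⟨h, Sym2.mem_mk_left _ _⟩ ⟨hg p, Sym2.mem_mk_left _ _⟩)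
  have hinv : ∀ p, g (g p) = p := fun p => (huniq _ _ (Sym2.eq_swap ▸ hg p)).symm
  have hF : IsNCPairing m fun p => (g (p : ZMod (2 * m))).val := by
    refine ⟨fun p _ => ZMod.val_lt _, fun p hp => ?_, fun p hp => ?_, fun p q hpq hq hlt => ?_⟩
    · simp [hinv, ZMod.val_cast_of_lt hp]
    · have := (isMEdge_iff _ _).1 (hE _ (hg p))
      rwa [ZMod.val_cast_of_lt hp] at this
    · have hpv : (p : ZMod (2 * m)).val = p := ZMod.val_cast_of_lt (by omega)
      have hqv : (q : ZMod (2 * m)).val = q := ZMod.val_cast_of_lt (by omega)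
      generalize (p : ZMod (2 * m)) = a at *
      generalize (q : ZMod (2 * m)) = b at *
      subst hpv hqv
      by_contra hcon
      have hac : a ≠ b := by rintro rfl; omega
      have h1 : g a ≠ b := by rintro rfl; omega
      have h2 : a ≠ g b := by rintro rfl; rw [hinv] at h1; exact h1 rfl
      have h3 : g a ≠ g b := fun h => hac (by rw [← hinv a, h, hinv])
      have v2 : a.val ≠ (g b).val := fun h => h2 (ZMod.val_injective _ h)
      have v3 : (g a).val ≠ (g b).val := fun h => h3 (ZMod.val_injective _ h)
      refine hC _ (hg a) _ (hg b) ⟨a, g a, b, g b, rfl, rfl, ?_, hac, h2, h1, h3, ?_, ?_, ?_⟩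
      · intro h; rw [← h] at hq; omega
      · intro h
        have := (isMEdge_iff _ _).1 (hE _ (hg b))
        rw [← h] at this
        omega
      · rw [strictBtw_iff]; omega
      · rw [strictBtw_iff]; omega
  refine ⟨_, hF, Finset.Subset.antisymm (fun e he => ?_) fun e he => ?_⟩
  · induction e with | _ a b
    have := hF.mem_pairingEdges (ZMod.val_lt a)
    simpa [← huniq a b he] using this
  · obtain ⟨p, -, rfl⟩ := Finset.mem_image.1 he
    simpa using hg p

theorem two_mul_edgeSign_mul_edgeLen (heven : Even m) {p q : ℕ} (hpq : p < q) (hq : q < 2 * m)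
    (hpar : p % 2 ≠ q % 2) :
    2 * (edgeSign m s((p : ZMod (2 * m)), (q : ZMod (2 * m))) *
        (edgeLen m s((p : ZMod (2 * m)), (q : ZMod (2 * m))) : ℤ)) =
      (-1) ^ p + ((-1) ^ p * p + (-1) ^ q * q) +
        2 * (m - 1) * (if p + m < q then (-1) ^ p else 0) := by
  have hm := Nat.even_iff.1 heven
  have hpv : (p : ZMod (2 * m)).val = p := ZMod.val_cast_of_lt (by omega)
  have hqv : (q : ZMod (2 * m)).val = q := ZMod.val_cast_of_lt hq
  have hd : ((q : ZMod (2 * m)) - p).val = q - p := by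
    rw [ZMod.val_sub_eq_ite, if_pos (by omega), hpv, hqv]
  have hd' : ((p : ZMod (2 * m)) - q).val = p + 2 * m - q := by
    rw [ZMod.val_sub_eq_ite, if_neg (by omega), hpv, hqv]
  split_ifs with hlong
  · rw [Sym2.eq_swap, edgeSign_of_lt (by omega) (by omega), edgeLen_of_lt (by omega) (by omega),
      hqv, hd']
    have hl : (2 : ℤ) * ((p + 2 * m - q - 1) / 2 : ℕ) = p + 2 * m - q - 1 := by omega
    rcases Nat.even_or_odd p with h | h
    · have h' : Odd q := by rw [Nat.even_iff] at h; rw [Nat.odd_iff]; omega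
      rw [if_pos h', h.neg_one_pow, h'.neg_one_pow]
      linarith
    · have h' : Even q := by rw [Nat.odd_iff] at h; rw [Nat.even_iff]; omega
      rw [if_neg (Nat.not_odd_iff_even.2 h'), h.neg_one_pow, h'.neg_one_pow]
      linarith
  · rw [edgeSign_of_lt (by omega) (by omega), edgeLen_of_lt (by omega) (by omega), hpv, hd]
    have hl : (2 : ℤ) * ((q - p - 1) / 2 : ℕ) = q - p - 1 := by omega
    rcases Nat.even_or_odd p with h | h
    · have h' : Odd q := by rw [Nat.even_iff] at h; rw [Nat.odd_iff]; omega
      rw [if_neg (Nat.not_odd_iff_even.2 h), h.neg_one_pow, h'.neg_one_pow]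
      linarith
    · have h' : Even q := by rw [Nat.odd_iff] at h; rw [Nat.even_iff]; omega
      rw [if_pos h, h.neg_one_pow, h'.neg_one_pow]
      linarith

theorem sum_range_two_mul_neg_one_pow_mul (n : ℕ) :
    ∑ p ∈ Finset.range (2 * n), (-1 : ℤ) ^ p * p = -n := by
  induction n with
  | zero => simp
  | succ n ih =>
    rw [mul_add, mul_one, Finset.sum_range_succ, Finset.sum_range_succ, ih,
      (even_two_mul n).neg_one_pow, (even_two_mul n).add_one.neg_one_pow]
    push_cast
    ring

namespace IsNCPairing

variable {F : ℕ → ℕ}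

theorem weight_eq (hF : IsNCPairing m F) (heven : Even m) :
    weight m (pairingEdges m F) =
      (m - 1) * longSum m F - {p ∈ leftEnds m F | Odd p}.card := by
  have hinj : Set.InjOn (fun p : ℕ => s((p : ZMod (2 * m)), ((F p : ℕ) : ZMod (2 * m))))
      (leftEnds m F) := by
    intro p hp q hq h
    obtain ⟨hp, hp'⟩ := mem_leftEnds.1 hp
    obtain ⟨hq, hq'⟩ := mem_leftEnds.1 hq
    have cast_inj : ∀ x < 2 * m, ∀ y < 2 * m, (x : ZMod (2 * m)) = y → x = y := by
      intro x hx y hy hxy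
      rw [← ZMod.val_cast_of_lt hx, hxy, ZMod.val_cast_of_lt hy]
    rcases Sym2.eq_iff.1 h with ⟨h1, -⟩ | ⟨h1, h2⟩
    · exact cast_inj _ hp _ hq h1
    · have := cast_inj _ hp _ (hF.lt q hq) h1
      have := cast_inj _ (hF.lt p hp) _ hq h2
      omega
  have hsum : 2 * weight m (pairingEdges m F) = ∑ p ∈ leftEnds m F, (-1 : ℤ) ^ p + -m +
      2 * (m - 1) * longSum m F := by
    rw [← sum_range_two_mul_neg_one_pow_mul, ← hF.sum_leftEnds, longSum, weight, pairingEdges,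
      Finset.sum_image hinj, Finset.mul_sum, Finset.mul_sum, ← Finset.sum_add_distrib,
      ← Finset.sum_add_distrib]
    refine Finset.sum_congr rfl fun p hp => ?_
    obtain ⟨hp, hlt⟩ := mem_leftEnds.1 hp
    exact two_mul_edgeSign_mul_edgeLen heven hlt (hF.lt p hp) (hF.parity p hp)
  have hodd : ∑ p ∈ leftEnds m F, (-1 : ℤ) ^ p =
      m - 2 * {p ∈ leftEnds m F | Odd p}.card := by
    have : ∀ p : ℕ, (-1 : ℤ) ^ p = 1 - 2 * if Odd p then 1 else 0 := by
      intro p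
      rcases Nat.even_or_odd p with h | h
      · simp [h.neg_one_pow, Nat.not_odd_iff_even.2 h]
      · simp [h.neg_one_pow, h]
    rw [Finset.sum_congr rfl fun p _ => this p, Finset.sum_sub_distrib, ← Finset.mul_sum,
      Finset.sum_boole, Finset.sum_const, hF.card_leftEnds]
    simp
  linarith

theorem zero_mem_leftEnds (hF : IsNCPairing m F) : 0 ∈ leftEnds m F := by
  have hpos : 0 < 2 * m := Nat.pos_of_neZero _
  have := hF.parity 0 hpos
  exact mem_leftEnds.2 ⟨hpos, Nat.pos_of_ne_zero fun h => this (by rw [h])⟩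

theorem weight_bounds (hF : IsNCPairing m F) (hm : 2 ≤ m) (heven : Even m) :
    -((m : ℤ) - 2) ≤ weight m (pairingEdges m F) ∧
      weight m (pairingEdges m F) ≤ (m : ℤ) - 2 := by
  have hcard := Finset.card_filter_add_card_filter_not (s := leftEnds m F) (fun p => Odd p)
  rw [hF.card_leftEnds] at hcard
  have hzero : 0 ∈ {p ∈ leftEnds m F | ¬ Odd p} :=
    Finset.mem_filter.2 ⟨hF.zero_mem_leftEnds, by simp⟩
  have two_even : ∀ j ∈ leftEnds m F, Even j → j ≠ 0 → 2 ≤ {p ∈ leftEnds m F | ¬ Odd p}.card :=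
    fun j hj hj' hj0 => Finset.one_lt_card.2
      ⟨j, Finset.mem_filter.2 ⟨hj, Nat.not_odd_iff_even.2 hj'⟩, 0, hzero, hj0⟩
  rw [hF.weight_eq heven]
  by_cases hlong : ∃ p ∈ leftEnds m F, p + m < F p
  · obtain ⟨i, hi, hmax⟩ := Finset.exists_max_image {p ∈ leftEnds m F | p + m < F p} id
      (by simpa [Finset.Nonempty] using hlong)
    obtain ⟨hi, hil⟩ := Finset.mem_filter.1 hi
    have hFi := hF.lt i (mem_leftEnds.1 hi).1
    rw [hF.longSum_eq_of_maximal hil (mem_leftEnds.1 hi).1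
      fun p hp hpl => hmax p (Finset.mem_filter.2 ⟨hp, hpl⟩)]
    have hsucc := hF.succ_mem_leftEnds (i := i) (by omega) hFi
    split_ifs with hpar
    · have hpos : 0 < {p ∈ leftEnds m F | Odd p}.card :=
        Finset.card_pos.2 ⟨i + 1, Finset.mem_filter.2 ⟨hsucc, hpar.add_one⟩⟩
      have hpos' := Finset.card_pos.2 ⟨0, hzero⟩
      omega
    · have := two_even (i + 1) hsucc (Nat.not_even_iff_odd.1 hpar).add_one (by omega)
      omega
  · push Not at hlong
    have hsum : longSum m F = 0 :=
      Finset.sum_eq_zero fun p hp => if_neg (not_lt.2 (hlong p hp))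
    have h0 := hlong 0 hF.zero_mem_leftEnds
    have hp0 := hF.parity 0 (by omega)
    have hmem : F 0 + 1 ∈ leftEnds m F := by
      have h1 := hF.parity (F 0 + 1) (by omega)
      have h2 := hF.invol (F 0 + 1) (by omega)
      have h3 := hF.invol 0 (by omega)
      have h4 := hF.noncrossing 0 (F (F 0 + 1))
      have h5 := hF.lt 0 (by omega)
      rw [mem_leftEnds]
      refine ⟨by omega, ?_⟩
      by_contra hcon
      have c1 : F (F 0 + 1) ≠ F 0 := fun h => by rw [h, h3] at h2; omega
      have c2 : F (F 0 + 1) ≠ 0 := fun h => by rw [h] at h2; omega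
      omega
    have := two_even _ hmem (by rw [Nat.even_iff]; omega) (by omega)
    rw [hsum]
    omega

end IsNCPairing

theorem weight_twoBlockPairing (heven : Even m) {t u : ℕ} (ht : 2 * t + 1 ≤ m)
    (hu : 2 * u + 1 ≤ m) (h : t + u + 2 ≤ m) :
    weight m (pairingEdges m (twoBlockPairing t u)) = -((t + u : ℕ) : ℤ) := by
  have hF := isNCPairing_twoBlockPairing h
  have hlong : IsNCPairing.longSum m (twoBlockPairing t u) = 0 := by
    refine Finset.sum_eq_zero fun p hp => if_neg ?_
    obtain ⟨hp, hlt⟩ := mem_leftEnds.1 hp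
    have := twoBlockPairing_spec t u p
    omega
  have hodd : {p ∈ leftEnds m (twoBlockPairing t u) | Odd p} =
      (Finset.range (t + u)).image fun j => if j < t then 2 * j + 1 else 2 * j + 3 := by
    ext p
    simp only [Finset.mem_filter, mem_leftEnds, Finset.mem_image, Finset.mem_range, Nat.odd_iff]
    constructor
    · rintro ⟨⟨h1, h2⟩, h3⟩
      have hspec := twoBlockPairing_spec t u p
      by_cases hp : p < 2 * t + 1
      · exact ⟨p / 2, by omega, by rw [if_pos] <;> omega⟩
      · exact ⟨p / 2 - 1, by omega, by rw [if_neg] <;> omega⟩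
    · rintro ⟨j, hj, rfl⟩
      split_ifs with hjt
      · have hspec := twoBlockPairing_spec t u (2 * j + 1)
        omega
      · have hspec := twoBlockPairing_spec t u (2 * j + 3)
        omega
  rw [hF.weight_eq heven, hlong, hodd, Finset.card_image_of_injective, Finset.card_range]
  · simp
  · intro a b hab
    dsimp only at hab
    split_ifs at hab <;> omega

theorem exists_weight_eq_neg (heven : Even m) {k : ℕ} (hk : k + 2 ≤ m) :
    ∃ M, IsNCMatching m M ∧ weight m M = -(k : ℤ) := by
  have hm := Nat.even_iff.1 heven
  obtain ⟨t, u, rfl, ht, hu⟩ : ∃ t u, k = t + u ∧ 2 * t + 1 ≤ m ∧ 2 * u + 1 ≤ m :=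
    ⟨k / 2, k - k / 2, by omega, by omega, by omega⟩
  exact ⟨_, (isNCPairing_twoBlockPairing hk).isNCMatching,
    weight_twoBlockPairing heven ht hu hk⟩

end MatchingWeight

/-- For even `m ≥ 2`, the weight of every non-crossing perfect matching on
`2m` points lies in the interval `[-(m-2), m-2]`, and conversely every integer
in this interval is the weight of some non-crossing perfect matching. -/
theorem matching_weight_range (m : ℕ) (hm : 2 ≤ m) (heven : Even m) :
    (∀ M : Finset (Sym2 (ZMod (2 * m))), IsNCMatching m M →
      -((m : ℤ) - 2) ≤ weight m M ∧ weight m M ≤ (m : ℤ) - 2) ∧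
    (∀ c : ℤ, -((m : ℤ) - 2) ≤ c → c ≤ (m : ℤ) - 2 →
      ∃ M : Finset (Sym2 (ZMod (2 * m))), IsNCMatching m M ∧ weight m M = c) := by
  have : NeZero (2 * m) := ⟨by omega⟩
  refine ⟨fun M hM => ?_, fun c h1 h2 => ?_⟩
  · obtain ⟨F, hF, rfl⟩ := hM.exists_pairing
    exact hF.weight_bounds hm heven
  · obtain ⟨M, hM, hw⟩ := exists_weight_eq_neg heven (k := c.natAbs) (by omega)
    rcases le_total c 0 with hc | hc
    · exact ⟨M, hM, by omega⟩
    · obtain ⟨M', hM', hw'⟩ := hM.exists_weight_neg heven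
      exact ⟨M', hM', by omega⟩
end

section
/- Let n ≥ 2 be an integer with ⌊n/2⌋ odd. Then the flip graph of permutations G_n^P contains no rainbow cycle. -/
/-! Rainbow cycles in the flip graph of permutations of `{1, …, n}`
(represented by `Equiv.Perm (Fin n)`), where two permutations are adjacent if
they differ in transposing the entries at two positions `i` and `j`, and the
corresponding edge is labeled by the pair `{i, j}`. -/

/-- A rainbow cycle of length `L` in the flip graph `G_n^P` of permutations,
encoded as an `L`-periodic sequence `V` of permutations: consecutive
permutations differ in transposing the entries at two positions (i.e.
`V (i+1) = V i * Equiv.swap a b` for some positions `a ≠ b`, and `{a, b}` is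
the label of that edge), no permutation is visited twice within a period, and
every one of the `C(n,2)` possible labels `{a, b}` appears exactly once per
period. -/
def IsRainbowCycleP (n L : ℕ) (V : ℕ → Equiv.Perm (Fin n)) : Prop :=
  0 < L ∧
  (∀ i, V (i + L) = V i) ∧
  (∀ i < L, ∀ j < L, V i = V j → i = j) ∧
  (∀ i, ∃ a b : Fin n, a ≠ b ∧ V (i + 1) = V i * Equiv.swap a b) ∧
  (∀ a b : Fin n, a ≠ b →
    ((Finset.range L).filter (fun i => V (i + 1) = V i * Equiv.swap a b)).card = 1)

open Equiv in
theorem Equiv.swap_eq_swap_iff_of_ne {α : Type*} [DecidableEq α] {a b c d : α}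
    (hab : a ≠ b) (hcd : c ≠ d) :
    swap a b = swap c d ↔ (c = a ∧ d = b) ∨ (c = b ∧ d = a) := by
  constructor
  · intro h
    have hc : swap a b c = d := by rw [h, swap_apply_left]
    rw [swap_apply_def] at hc
    grind
  · rintro (⟨rfl, rfl⟩ | ⟨rfl, rfl⟩)
    · rfl
    · exact swap_comm _ _

theorem card_offDiag_filter_mul_swap {α : Type*} [Fintype α] [DecidableEq α]
    {a b : α} (hab : a ≠ b) (σ : Equiv.Perm α) :
    ((Finset.univ : Finset α).offDiag.filter
      (fun p => σ * Equiv.swap a b = σ * Equiv.swap p.1 p.2)).card = 2 := by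
  have h : (Finset.univ : Finset α).offDiag.filter
      (fun p => σ * Equiv.swap a b = σ * Equiv.swap p.1 p.2) = {(a, b), (b, a)} := by
    ext ⟨c, d⟩
    simp only [Finset.mem_filter, Finset.mem_offDiag, Finset.mem_univ, true_and, mul_right_inj,
      Finset.mem_insert, Finset.mem_singleton, Prod.mk.injEq]
    constructor
    · rintro ⟨hcd, h⟩
      exact (Equiv.swap_eq_swap_iff_of_ne hab hcd).1 h
    · intro h
      have hcd : c ≠ d := by grind
      exact ⟨hcd, (Equiv.swap_eq_swap_iff_of_ne hab hcd).2 h⟩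
  rw [h, Finset.card_pair]
  simp [hab]

theorem IsRainbowCycleP.two_mul_length {n L : ℕ} {V : ℕ → Equiv.Perm (Fin n)}
    (h : IsRainbowCycleP n L V) : 2 * L = n * n - n := by
  obtain ⟨-, -, -, hstep, hlabel⟩ := h
  have hcount := Finset.sum_card_bipartiteAbove_eq_sum_card_bipartiteBelow
    (s := Finset.range L) (t := (Finset.univ : Finset (Fin n)).offDiag)
    (fun i p => V (i + 1) = V i * Equiv.swap p.1 p.2)
  rw [Finset.sum_congr rfl (g := fun _ => 2)] at hcount
  · simp only [Finset.bipartiteBelow] at hcount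
    rw [Finset.sum_congr rfl fun p hp => hlabel p.1 p.2 (Finset.mem_offDiag.1 hp).2.2] at hcount
    simpa [Finset.offDiag_card, mul_comm] using hcount
  · intro i _
    obtain ⟨a, b, hab, hV⟩ := hstep i
    simp only [Finset.bipartiteAbove, hV]
    exact card_offDiag_filter_mul_swap hab (V i)

theorem IsRainbowCycleP.even_length {n L : ℕ} {V : ℕ → Equiv.Perm (Fin n)}
    (h : IsRainbowCycleP n L V) : Even L := by
  obtain ⟨-, hper, -, hstep, -⟩ := h
  have hsign : ∀ i, Equiv.Perm.sign (V i) = Equiv.Perm.sign (V 0) * (-1) ^ i := by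
    intro i
    induction i with
    | zero => simp
    | succ i ih =>
      obtain ⟨a, b, hab, hV⟩ := hstep i
      rw [hV, Equiv.Perm.sign_mul, Equiv.Perm.sign_swap hab, ih, pow_succ, mul_assoc]
  have hL := hsign L
  rw [← zero_add L, hper 0, zero_add, left_eq_mul] at hL
  by_contra hodd
  rw [Nat.not_even_iff_odd] at hodd
  rw [hodd.neg_one_pow] at hL
  exact absurd hL (by decide)

/-- For every `n ≥ 2` with `⌊n/2⌋` odd, the flip graph of permutations of
`{1, …, n}` contains no rainbow cycle. -/
theorem permutations_no_rainbow_cycle (n : ℕ) (hn : 2 ≤ n) (hodd : Odd (n / 2)) :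
    ¬ ∃ (L : ℕ) (V : ℕ → Equiv.Perm (Fin n)), IsRainbowCycleP n L V := by
  rintro ⟨L, V, hV⟩
  have hlen := hV.two_mul_length
  obtain ⟨m, rfl⟩ := hV.even_length
  obtain ⟨k, hk⟩ := hodd
  have hmod : n * n = 4 * m + n := by
    have := Nat.le_mul_self n
    omega
  obtain rfl | rfl : n = 4 * k + 2 ∨ n = 4 * k + 3 := by omega
  all_goals
    ring_nf at hmod
    omega
end

section
/- Let n ≥ 2 be an integer with ⌊n/2⌋ even. Then the flip graph of permutations G_n^P contains a rainbow cycle, i.e., a cycle of length C(n,2) visiting no permutation twice along which each of the C(n,2) transpositions {i,j} of positions appears exactly once. -/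
namespace RainbowPerm

open Equiv

variable {α β : Type*}

/-- The unordered pair of positions underlying an ordered one. -/
def label (p : α × α) : Sym2 α := s(p.1, p.2)

/-- A list of transpositions with product `(a b)` whose labels are `{a, b}` and all `{a, x}`,
`{b, x}` with `x` in the given list. -/
def block (a b : α) : List α → List (α × α)
  | [] => [(a, b)]
  | x :: xs => (a, x) :: (block a b xs ++ [(b, x)])

theorem mem_block {a b : α} {xs : List α} {p : α × α} :
    p ∈ block a b xs ↔ p = (a, b) ∨ ∃ x ∈ xs, p = (a, x) ∨ p = (b, x) := by
  induction xs with
  | nil => simp [block]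
  | cons x xs ih => simp only [block, List.mem_cons, List.mem_append, ih, List.not_mem_nil]; grind

theorem nodup_label_block {a b : α} {xs : List α} (hab : a ≠ b) (ha : a ∉ xs) (hb : b ∉ xs)
    (hxs : xs.Nodup) : ((block a b xs).map label).Nodup := by
  induction xs with
  | nil => simp [block]
  | cons x xs ih =>
    simp only [List.mem_cons, not_or, List.nodup_cons] at ha hb hxs
    have h := ih ha.2 hb.2 hxs.2
    simp only [block, List.map_cons, List.map_append, List.map_nil, List.nodup_cons,
      List.mem_append, List.mem_map, mem_block, List.mem_singleton, List.nodup_append]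
    refine ⟨?_, h, by simp, ?_⟩
    · simp only [label]
      grind [Sym2.eq_iff]
    · simp only [label]
      grind [Sym2.eq_iff]

variable [DecidableEq α] [DecidableEq β]

/-- The transposition of the two entries of a pair. -/
def swapOf (p : α × α) : Perm α := swap p.1 p.2

/-- The permutations met when applying the transpositions of a list one after the other,
starting from `g`; the last permutation reached is omitted. -/
def visited : Perm α → List (α × α) → List (Perm α)
  | _, [] => []
  | g, p :: l => g :: visited (g * swapOf p) l

theorem visited_append (g : Perm α) (l₁ l₂ : List (α × α)) :
    visited g (l₁ ++ l₂) = visited g l₁ ++ visited (g * (l₁.map swapOf).prod) l₂ := by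
  induction l₁ generalizing g with
  | nil => simp [visited]
  | cons p l ih => simp [visited, ih, mul_assoc]

theorem length_visited (g : Perm α) (l : List (α × α)) : (visited g l).length = l.length := by
  induction l generalizing g with
  | nil => rfl
  | cons p l ih => simp [visited, ih]

theorem getElem_visited (g : Perm α) (l : List (α × α)) (i : ℕ) (hi : i < (visited g l).length) :
    (visited g l)[i] = g * ((l.take i).map swapOf).prod := by
  induction l generalizing g i with
  | nil => simp [visited] at hi
  | cons p l ih =>
    cases i with
    | zero => simp [visited]
    | succ i => simp [visited, ih, mul_assoc]

theorem swap_eq_swap_iff_label {a b : α} (p : α × α) (hab : a ≠ b) :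
    swapOf p = swap a b ↔ label p = s(a, b) := by
  obtain ⟨c, d⟩ := p
  simp only [swapOf, label, Sym2.eq_iff]
  constructor
  · intro h
    have h1 := congrArg (fun f : Perm α => f a) h
    simp only [swap_apply_left, swap_apply_def] at h1
    grind
  · rintro (⟨rfl, rfl⟩ | ⟨rfl, rfl⟩)
    · rfl
    · exact swap_comm _ _

theorem swapOf_ne_one {p : α × α} (h : p.1 ≠ p.2) : swapOf p ≠ 1 := by
  intro h1
  have := congrArg (fun f : Perm α => f p.1) h1
  simp [swapOf] at this
  exact h this.symm

/-- A list of transpositions tracing out a rainbow cycle from the identity. -/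
structure IsRainbowList (l : List (α × α)) : Prop where
  nodup_label : (l.map label).Nodup
  mem_label_iff : ∀ e, e ∈ l.map label ↔ ¬ e.IsDiag
  prod_eq_one : (l.map swapOf).prod = 1
  nodup_visited : (visited 1 l).Nodup

theorem IsRainbowList.ne {l : List (α × α)} (h : IsRainbowList l) {p : α × α} (hp : p ∈ l) :
    p.1 ≠ p.2 := by
  simpa [label] using (h.mem_label_iff (label p)).1 (List.mem_map_of_mem hp)

theorem IsRainbowList.length {n : ℕ} {l : List (Fin n × Fin n)} (h : IsRainbowList l) :
    l.length = n.choose 2 := by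
  have h1 : (l.map label).toFinset = Finset.univ.filter (fun e : Sym2 (Fin n) => ¬ e.IsDiag) := by
    ext e
    simp only [List.mem_toFinset, h.mem_label_iff, Finset.mem_filter, Finset.mem_univ, true_and]
  have h2 := List.toFinset_card_of_nodup h.nodup_label
  rw [h1, ← Fintype.card_subtype, Sym2.card_subtype_not_diag] at h2
  simpa using h2.symm

theorem IsRainbowList.exists_isRainbowCycleP {n : ℕ} (hn : 2 ≤ n) {l : List (Fin n × Fin n)}
    (h : IsRainbowList l) :
    ∃ V : ℕ → Perm (Fin n), IsRainbowCycleP n (n.choose 2) V := by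
  have hL := h.length
  have hpos : 0 < n.choose 2 := Nat.choose_pos hn
  rw [← hL] at hpos ⊢
  have step : ∀ i, ((l.take ((i + 1) % l.length)).map swapOf).prod =
      ((l.take (i % l.length)).map swapOf).prod *
        swapOf (l[i % l.length]'(Nat.mod_lt _ hpos)) := by
    intro i
    have hi := Nat.mod_lt i hpos
    have key := List.prod_take_succ (l.map swapOf) (i % l.length) (by simpa using hi)
    simp only [List.map_take, List.getElem_map] at key ⊢
    rw [← key, ← Nat.mod_add_mod]
    by_cases h1 : i % l.length + 1 < l.length
    · rw [Nat.mod_eq_of_lt h1]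
    · have h2 : i % l.length + 1 = l.length := by omega
      rw [h2, Nat.mod_self, List.take_of_length_le (i := l.length) (by simp), h.prod_eq_one]
      simp
  refine ⟨fun i => ((l.take (i % l.length)).map swapOf).prod, hpos, fun i => by simp, ?_, ?_, ?_⟩
  · intro i hi j hj hij
    simp only [Nat.mod_eq_of_lt hi, Nat.mod_eq_of_lt hj] at hij
    have hv := length_visited 1 l
    refine (h.nodup_visited.getElem_inj_iff (hi := by omega) (hj := by omega)).1 ?_
    simpa [getElem_visited] using hij
  · intro i
    exact ⟨_, _, h.ne (List.getElem_mem (Nat.mod_lt i hpos)), step i⟩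
  · intro a b hab
    obtain ⟨k, hk, hke⟩ := List.mem_iff_getElem.1 ((h.mem_label_iff s(a, b)).2 (by simpa using hab))
    rw [Finset.card_eq_one]
    refine ⟨k, ?_⟩
    ext i
    simp only [Finset.mem_filter, Finset.mem_range, Finset.mem_singleton, step, mul_right_inj,
      swap_eq_swap_iff_label _ hab]
    have hk' : k < l.length := by simpa using hk
    simp only [List.getElem_map] at hke
    constructor
    · rintro ⟨hi, he⟩
      refine (h.nodup_label.getElem_inj_iff (hi := by simpa using hi) (hj := hk)).1 ?_
      simp only [Nat.mod_eq_of_lt hi] at he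
      simp [he, hke]
    · rintro rfl
      simp only [Nat.mod_eq_of_lt hk']
      exact ⟨hk', hke⟩

theorem visited_map {f : α → β} {φ : Perm α →* Perm β}
    (hφ : ∀ p, swapOf (Prod.map f f p) = φ (swapOf p)) (k : Perm β) (g : Perm α)
    (l : List (α × α)) :
    visited (k * φ g) (l.map (Prod.map f f)) = (visited g l).map (fun h => k * φ h) := by
  induction l generalizing g with
  | nil => rfl
  | cons p l ih =>
    rw [List.map_cons, visited, visited, hφ, mul_assoc, ← map_mul, ih, List.map_cons]

theorem prod_map {f : α → β} {φ : Perm α →* Perm β}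
    (hφ : ∀ p, swapOf (Prod.map f f p) = φ (swapOf p)) (l : List (α × α)) :
    ((l.map (Prod.map f f)).map swapOf).prod = φ (l.map swapOf).prod := by
  rw [map_list_prod, List.map_map, List.map_map]
  exact congrArg List.prod (List.map_congr_left fun p _ => hφ p)

theorem swapOf_map_equiv (e : α ≃ β) (p : α × α) :
    swapOf (Prod.map e e p) = e.permCongrHom.toMonoidHom (swapOf p) :=
  (symm_trans_swap_trans p.1 p.2 e).symm

theorem IsRainbowList.map_equiv {l : List (α × α)} (h : IsRainbowList l) (e : α ≃ β) :
    IsRainbowList (l.map (Prod.map e e)) := by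
  have hl : (l.map (Prod.map e e)).map label = (l.map label).map (Sym2.map e) := by
    simp [List.map_map, Function.comp_def, label]
  refine ⟨?_, ?_, ?_, ?_⟩
  · rw [hl]
    exact h.nodup_label.map (Sym2.map.injective e.injective)
  · intro f
    obtain ⟨f, rfl⟩ : ∃ f', Sym2.map e f' = f :=
      ⟨Sym2.map e.symm f, by rw [Sym2.map_map]; simp⟩
    rw [hl, List.mem_map_of_injective (Sym2.map.injective e.injective), h.mem_label_iff]
    induction f with
    | _ a b => simp
  · rw [prod_map (swapOf_map_equiv e), h.prod_eq_one, map_one]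
  · have := visited_map (swapOf_map_equiv e) 1 1 l
    rw [map_one, one_mul] at this
    rw [this]
    exact h.nodup_visited.map (by simpa using e.permCongrHom.injective)

/-! ### Replacing one transposition by a conjugation through new positions -/

theorem prod_block {a b : α} {xs : List α} (ha : a ∉ xs) (hb : b ∉ xs) :
    ((block a b xs).map swapOf).prod = swap a b := by
  induction xs with
  | nil => simp [block, swapOf]
  | cons x xs ih =>
    simp only [List.mem_cons, not_or] at ha hb
    simp only [block, List.map_cons, List.map_append, List.prod_cons, List.prod_append,
      ih ha.2 hb.2, List.map_nil, List.prod_nil, mul_one, swapOf]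
    rw [mul_swap_eq_swap_mul, swap_apply_right,
      swap_apply_of_ne_of_ne (Ne.symm ha.1) (Ne.symm hb.1), ← mul_assoc, swap_mul_self, one_mul]

theorem mem_visited_block {a b : α} {xs : List α} (hab : a ≠ b) (ha : a ∉ xs) (hb : b ∉ xs)
    (hxs : xs.Nodup) {g h : Perm α} (hh : h ∈ visited g (block a b xs)) :
    (h = g ∨ (h b = g b ∧ ∃ x ∈ xs, h a = g x) ∨ (h a = g b ∧ ∃ x ∈ xs, h b = g x)) ∧
      ∀ c, c ≠ a → c ≠ b → c ∉ xs → h c = g c := by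
  induction xs generalizing g with
  | nil => simp_all [block, visited]
  | cons x xs ih =>
    simp only [List.mem_cons, not_or, List.nodup_cons] at ha hb hxs
    simp only [block, visited, visited_append, prod_block ha.2 hb.2, List.mem_cons,
      List.mem_append, List.not_mem_nil, or_false] at hh
    have hga : (g * swapOf (a, x)) a = g x := by simp [swapOf]
    have hg : ∀ c, c ≠ a → c ≠ x → (g * swapOf (a, x)) c = g c := fun c h1 h2 => by
      simp [swapOf, swap_apply_of_ne_of_ne h1 h2]
    have hgx : ∀ c ∈ xs, (g * swapOf (a, x)) c = g c := fun c hc =>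
      hg c (fun h => ha.2 (h ▸ hc)) (fun h => hxs.1 (h ▸ hc))
    rcases hh with rfl | hh | rfl
    · simp
    · have := ih ha.2 hb.2 hxs.2 hh
      grind
    · have h1 : (g * swapOf (a, x) * swap a b) a = g b := by
        rw [Perm.mul_apply, swap_apply_left, hg b hab.symm hb.1]
      have h2 : (g * swapOf (a, x) * swap a b) b = g x := by
        rw [Perm.mul_apply, swap_apply_right, hga]
      refine ⟨Or.inr (Or.inr ⟨h1, x, by simp, h2⟩), fun c hca hcb hc => ?_⟩
      rw [Perm.mul_apply, swap_apply_of_ne_of_ne hca hcb, hg c hca (by grind)]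

theorem nodup_visited_block {a b : α} {xs : List α} (hab : a ≠ b) (ha : a ∉ xs) (hb : b ∉ xs)
    (hxs : xs.Nodup) (g : Perm α) : (visited g (block a b xs)).Nodup := by
  induction xs generalizing g with
  | nil => simp [block, visited]
  | cons x xs ih =>
    simp only [List.mem_cons, not_or, List.nodup_cons] at ha hb hxs
    simp only [block, visited, visited_append, prod_block ha.2 hb.2, List.nodup_cons,
      List.mem_append, List.nodup_append, List.mem_singleton]
    have hga : (g * swapOf (a, x)) a = g x := by simp [swapOf]
    have hg : ∀ c, c ≠ a → c ≠ x → (g * swapOf (a, x)) c = g c := fun c h1 h2 => by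
      simp [swapOf, swap_apply_of_ne_of_ne h1 h2]
    have hgx : ∀ c ∈ xs, (g * swapOf (a, x)) c = g c := fun c hc =>
      hg c (fun h => ha.2 (h ▸ hc)) (fun h => hxs.1 (h ▸ hc))
    have h1 : (g * swapOf (a, x) * swap a b) a = g b := by
      rw [Perm.mul_apply, swap_apply_left, hg b hab.symm hb.1]
    have h2 : (g * swapOf (a, x) * swap a b) b = g x := by
      rw [Perm.mul_apply, swap_apply_right, hga]
    have hinj := g.injective
    refine ⟨?_, ih ha.2 hb.2 hxs.2 _, by simp, ?_⟩
    · rintro (h | h)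
      · have := (mem_visited_block hab ha.2 hb.2 hxs.2 h).1
        grind [Function.Injective]
      · grind [Function.Injective]
    · rintro h hh _ rfl rfl
      have := (mem_visited_block hab ha.2 hb.2 hxs.2 hh).1
      grind [Function.Injective]

/-- Replace the transpositions `(c, σ c)` of a list by blocks through the positions `xs`. -/
def expand (σ : α → α) (xs : List α) (p : α × α) : List (α × α) :=
  if σ p.1 = p.2 then block p.1 p.2 xs else [p]

theorem prod_flatMap_expand {σ : α → α} {xs : List α} (hxs : ∀ x ∈ xs, σ x = x)
    (hσ : Function.Involutive σ) {l : List (α × α)} (hl : ∀ p ∈ l, p.1 ≠ p.2) :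
    ((l.flatMap (expand σ xs)).map swapOf).prod = (l.map swapOf).prod := by
  induction l with
  | nil => simp
  | cons p l ih =>
    simp only [List.mem_cons, forall_eq_or_imp] at hl
    have : ((expand σ xs p).map swapOf).prod = swapOf p := by
      unfold expand
      split_ifs with h
      · exact prod_block (fun h' => hl.1 (by rw [← h, hxs _ h']))
          (fun h' => hl.1 (by rw [← hσ p.1, h, hxs _ h']))
      · simp
    simp [ih hl.2, this]

theorem mem_visited_flatMap_expand {σ : α → α} {xs : List α} (hx : xs.Nodup)
    (hσ : Function.Involutive σ) (hσx : ∀ c, σ c = c ↔ c ∈ xs) {l : List (α × α)}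
    (hl : ∀ p ∈ l, p.1 ≠ p.2 ∧ (p.1 ∈ xs ↔ p.2 ∈ xs)) {g : Perm α}
    (hg : ∀ c, g c ∈ xs ↔ c ∈ xs) {h : Perm α} (hh : h ∈ visited g (l.flatMap (expand σ xs))) :
    (h ∈ visited g l ∧ ∀ c, h c ∈ xs ↔ c ∈ xs) ∨
      ∃ p ∈ l, σ p.1 = p.2 ∧ p.1 ∉ xs ∧ p.2 ∉ xs ∧ (h p.1 ∈ xs ∨ h p.2 ∈ xs) ∧
        ∀ c, c ≠ p.1 → c ≠ p.2 → c ∉ xs → h c ∉ xs := by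
  induction l generalizing g with
  | nil => simp [visited] at hh
  | cons p l ih =>
    rw [List.forall_mem_cons] at hl
    obtain ⟨⟨hne, hiff⟩, hl⟩ := hl
    have hg' : ∀ c, (g * swapOf p) c ∈ xs ↔ c ∈ xs := by
      intro c
      rw [Perm.mul_apply, hg]
      simp only [swapOf, swap_apply_def]
      grind
    have hp : ((expand σ xs p).map swapOf).prod = swapOf p := by
      simpa using prod_flatMap_expand (l := [p]) (fun x h => (hσx x).2 h) hσ (by simpa using hne)
    rw [List.flatMap_cons, visited_append, hp, List.mem_append] at hh
    rcases hh with hh | hh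
    · by_cases hm : σ p.1 = p.2
      · have h1 : p.1 ∉ xs := fun h' => hne (by rw [← hm, (hσx _).2 h'])
        have h2 : p.2 ∉ xs := fun h' => h1 (hiff.2 h')
        rw [expand, if_pos hm] at hh
        obtain ⟨h3, h4⟩ := mem_visited_block hne h1 h2 hx hh
        rcases h3 with rfl | h3
        · exact Or.inl ⟨by simp [visited], hg⟩
        · refine Or.inr ⟨p, by simp, hm, h1, h2, ?_, fun c hc1 hc2 hc => ?_⟩
          · rcases h3 with ⟨-, x, hxx, h3⟩ | ⟨-, x, hxx, h3⟩
            · exact Or.inl (by rwa [h3, hg])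
            · exact Or.inr (by rwa [h3, hg])
          · rwa [h4 c hc1 hc2 hc, hg]
      · rw [expand, if_neg hm] at hh
        obtain rfl : h = g := by simpa [visited] using hh
        exact Or.inl ⟨by simp [visited], hg⟩
    · rcases ih hl hg' hh with h1 | ⟨q, hq, h1⟩
      · exact Or.inl ⟨by simp [visited, h1.1], h1.2⟩
      · exact Or.inr ⟨q, by simp [hq], h1⟩

theorem nodup_visited_flatMap_expand {σ : α → α} {xs : List α} (hx : xs.Nodup)
    (hσ : Function.Involutive σ) (hσx : ∀ c, σ c = c ↔ c ∈ xs) {l : List (α × α)}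
    (hl : ∀ p ∈ l, p.1 ≠ p.2 ∧ (p.1 ∈ xs ↔ p.2 ∈ xs)) (hlabel : (l.map label).Nodup)
    {g : Perm α} (hg : ∀ c, g c ∈ xs ↔ c ∈ xs) (hv : (visited g l).Nodup) :
    (visited g (l.flatMap (expand σ xs))).Nodup := by
  induction l generalizing g with
  | nil => simp [visited]
  | cons p l ih =>
    rw [List.forall_mem_cons] at hl
    obtain ⟨⟨hne, hiff⟩, hl⟩ := hl
    rw [List.map_cons, List.nodup_cons] at hlabel
    rw [visited, List.nodup_cons] at hv
    have hg' : ∀ c, (g * swapOf p) c ∈ xs ↔ c ∈ xs := by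
      intro c
      rw [Perm.mul_apply, hg]
      simp only [swapOf, swap_apply_def]
      grind
    have hp : ((expand σ xs p).map swapOf).prod = swapOf p := by
      simpa using prod_flatMap_expand (l := [p]) (fun x h => (hσx x).2 h) hσ (by simpa using hne)
    rw [List.flatMap_cons, visited_append, hp]
    refine List.Nodup.append ?_ (ih hl hlabel.2 hg' hv.2) ?_
    · unfold expand
      split_ifs with hm
      · have h1 : p.1 ∉ xs := fun h' => hne (by rw [← hm, (hσx _).2 h'])
        exact nodup_visited_block hne h1 (fun h' => h1 (hiff.2 h')) hx g
      · simp [visited]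
    · intro h h1 h2
      have h1 := mem_visited_flatMap_expand hx hσ hσx (l := [p]) (by simpa using ⟨hne, hiff⟩) hg
        (h := h) (by simpa using h1)
      have h2 := mem_visited_flatMap_expand hx hσ hσx hl hg' h2
      simp only [List.mem_singleton, exists_eq_left] at h1
      rcases h1 with ⟨h1, h1'⟩ | ⟨h1a, h1b, h1c, h1d, h1e⟩
      · rcases h2 with ⟨h2, -⟩ | ⟨q, -, -, h2a, h2b, h2c, -⟩
        · obtain rfl : h = g := by simpa [visited] using h1
          exact hv.1 h2
        · simp only [h1', h2a, h2b, or_self] at h2c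
      · rcases h2 with ⟨-, h2⟩ | ⟨q, hq, h2m, h2a, h2b, h2c, h2d⟩
        · simp only [h2, h1b, h1c, or_self] at h1d
        · apply hlabel.1
          have : label q = label p := by
            simp only [label, Sym2.eq_iff]
            have e1 := hσ p.1
            have e2 := hσ q.1
            grind
          exact this ▸ List.mem_map_of_mem hq

theorem mem_label_expand {σ : α → α} {xs : List α} {p : α × α} {e : Sym2 α} :
    e ∈ (expand σ xs p).map label ↔
      e = label p ∨ (σ p.1 = p.2 ∧ ∃ x ∈ xs, e = s(p.1, x) ∨ e = s(p.2, x)) := by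
  unfold expand
  split_ifs with h
  · simp only [List.mem_map, mem_block, label]
    constructor
    · rintro ⟨q, rfl | ⟨x, hx, rfl | rfl⟩, rfl⟩ <;> simp [*] <;> grind
    · rintro (rfl | ⟨-, x, hx, rfl | rfl⟩)
      · exact ⟨p, by simp⟩
      · exact ⟨(p.1, x), by grind, rfl⟩
      · exact ⟨(p.2, x), by grind, rfl⟩
  · simp [h]

theorem IsRainbowList.flatMap_expand {σ : α → α} {xs : List α} (hx : xs.Nodup)
    (hσ : Function.Involutive σ) (hσx : ∀ c, σ c = c ↔ c ∈ xs) {l : List (α × α)}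
    (hl : ∀ p ∈ l, p.1 ≠ p.2 ∧ (p.1 ∈ xs ↔ p.2 ∈ xs)) (hlabel : (l.map label).Nodup)
    (hmem : ∀ a b, a ≠ b → (a ∈ xs ↔ b ∈ xs) → s(a, b) ∈ l.map label)
    (hprod : (l.map swapOf).prod = 1) (hv : (visited 1 l).Nodup) :
    IsRainbowList (l.flatMap (expand σ xs)) := by
  have hnew : ∀ p ∈ l, σ p.1 = p.2 → p.1 ∉ xs ∧ p.2 ∉ xs := fun p hp hm => by
    have h1 : p.1 ∉ xs := fun h' => (hl p hp).1 (by rw [← hm, (hσx _).2 h'])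
    exact ⟨h1, fun h' => h1 ((hl p hp).2.2 h')⟩
  refine ⟨?_, ?_, ?_, nodup_visited_flatMap_expand hx hσ hσx hl hlabel (by simp) hv⟩
  · rw [List.map_flatMap, List.nodup_flatMap]
    constructor
    · intro p hp
      unfold expand
      split_ifs with hm
      · exact nodup_label_block (hl p hp).1 (hnew p hp hm).1 (hnew p hp hm).2 hx
      · simp
    · rw [List.Nodup, List.pairwise_map] at hlabel
      refine hlabel.imp_of_mem ?_
      intro p q hp hq hpq e hep heq
      rw [mem_label_expand] at hep heq
      have := hl p hp
      have := hl q hq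
      have := hnew p hp
      have := hnew q hq
      have e1 := hσ p.1
      have e2 := hσ q.1
      apply hpq
      rcases hep with rfl | ⟨hm, x, hxx, hep⟩
      · rcases heq with h | ⟨hm, x, hxx, heq⟩
        · exact h
        · simp only [label, Sym2.eq_iff] at heq
          grind
      · rcases heq with rfl | ⟨hm', y, hy, heq⟩
        · simp only [label, Sym2.eq_iff] at hep
          grind
        · have : p.1 = q.1 ∨ p.1 = q.2 ∨ p.2 = q.1 ∨ p.2 = q.2 := by
            rcases hep with rfl | rfl <;> rw [Sym2.eq_iff, Sym2.eq_iff] at heq <;> grind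
          simp only [label, Sym2.eq_iff]
          grind
  · intro e
    rw [List.map_flatMap, List.mem_flatMap]
    simp only [mem_label_expand]
    constructor
    · rintro ⟨p, hp, rfl | ⟨hm, x, hxx, h⟩⟩
      · simpa [label] using (hl p hp).1
      · have := hnew p hp hm
        rcases h with rfl | rfl <;> simp only [Sym2.mk_isDiag_iff] <;> grind
    · have hcross : ∀ a x, a ∉ xs → x ∈ xs → ∃ p ∈ l, s(a, x) = label p ∨
          (σ p.1 = p.2 ∧ ∃ y ∈ xs, s(a, x) = s(p.1, y) ∨ s(a, x) = s(p.2, y)) := by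
        intro a x ha hxx
        have h1 : σ a ≠ a := fun h => ha ((hσx a).1 h)
        have h2 : σ a ∉ xs := fun h => h1 (by rw [← hσx, hσ] at h; exact h.symm)
        obtain ⟨p, hp, hpe⟩ := List.mem_map.1 (hmem a (σ a) h1.symm (by simp [ha, h2]))
        refine ⟨p, hp, Or.inr ?_⟩
        rw [label, Sym2.eq_iff] at hpe
        rcases hpe with ⟨h3, h4⟩ | ⟨h3, h4⟩
        · exact ⟨by rw [h3, h4], x, hxx, Or.inl (by rw [h3])⟩
        · exact ⟨by rw [h3, h4, hσ], x, hxx, Or.inr (by rw [h4])⟩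
      induction e with
      | _ a b =>
        rw [Sym2.mk_isDiag_iff]
        intro hab
        by_cases ha : a ∈ xs <;> by_cases hb : b ∈ xs
        · obtain ⟨p, hp, h⟩ := List.mem_map.1 (hmem a b hab (by simp [ha, hb]))
          exact ⟨p, hp, Or.inl h.symm⟩
        · rw [Sym2.eq_swap]
          exact hcross b a hb ha
        · exact hcross a b ha hb
        · obtain ⟨p, hp, h⟩ := List.mem_map.1 (hmem a b hab (by simp [ha, hb]))
          exact ⟨p, hp, Or.inl h.symm⟩
  · rw [prod_flatMap_expand (fun x h => (hσx x).2 h) hσ (fun p hp => (hl p hp).1), hprod]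

/-! ### Combining two lists on disjoint sets of positions -/

theorem swapOf_map_inl (p : α × α) :
    swapOf (Prod.map (Sum.inl : α → α ⊕ β) Sum.inl p) =
      ((Perm.sumCongrHom α β).comp (MonoidHom.inl _ _)) (swapOf p) :=
  (Perm.sumCongr_swap_one p.1 p.2).symm

theorem swapOf_map_inr (p : β × β) :
    swapOf (Prod.map (Sum.inr : β → α ⊕ β) Sum.inr p) =
      ((Perm.sumCongrHom α β).comp (MonoidHom.inr _ _)) (swapOf p) :=
  (Perm.sumCongr_one_swap p.1 p.2).symm

theorem IsRainbowList.exists_merge {l : List (α × α)} {t : List (β × β)} (hl : IsRainbowList l)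
    (hl0 : l ≠ []) (ht : IsRainbowList t) :
    ∃ L : List ((α ⊕ β) × (α ⊕ β)),
      L.Perm (l.map (Prod.map Sum.inl Sum.inl) ++ t.map (Prod.map Sum.inr Sum.inr)) ∧
      (L.map swapOf).prod = 1 ∧ (visited 1 L).Nodup := by
  have hinj : Function.Injective (Perm.sumCongrHom α β) := Perm.sumCongrHom_injective
  cases t with
  | nil =>
    refine ⟨_, by rw [List.map_nil, List.append_nil], ?_, ?_⟩
    · rw [prod_map swapOf_map_inl, hl.prod_eq_one, map_one]
    · have := visited_map (swapOf_map_inl (β := β)) 1 1 l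
      rw [map_one, one_mul] at this
      rw [this]
      refine hl.nodup_visited.map fun u v huv => ?_
      rw [one_mul, one_mul] at huv
      exact congrArg Prod.fst (hinj huv)
  | cons q t =>
    obtain ⟨p, l, rfl⟩ := List.exists_cons_of_ne_nil hl0
    have hp := swapOf_ne_one (hl.ne List.mem_cons_self)
    have hq := swapOf_ne_one (ht.ne List.mem_cons_self)
    have hlp := hl.prod_eq_one
    have htp := ht.prod_eq_one
    have hlv := hl.nodup_visited
    have htv := ht.nodup_visited
    simp only [List.map_cons, List.prod_cons] at hlp htp
    simp only [visited, List.nodup_cons, one_mul] at hlv htv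
    refine ⟨Prod.map Sum.inl Sum.inl p :: Prod.map Sum.inr Sum.inr q ::
      (l.map (Prod.map Sum.inl Sum.inl) ++ t.map (Prod.map Sum.inr Sum.inr)), ?_, ?_, ?_⟩
    · simp only [List.map_cons, List.cons_append]
      exact (List.perm_middle.symm).cons _
    · simp only [List.map_cons, List.prod_cons, List.map_append, List.prod_append,
        prod_map swapOf_map_inl, prod_map swapOf_map_inr, swapOf_map_inl, swapOf_map_inr,
        MonoidHom.comp_apply, MonoidHom.inl_apply, MonoidHom.inr_apply, ← map_mul, Prod.mk_mul_mk,
        one_mul, mul_one, hlp, htp]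
      exact map_one _
    · have key : visited 1 (Prod.map Sum.inl Sum.inl p :: Prod.map Sum.inr Sum.inr q ::
          (l.map (Prod.map Sum.inl Sum.inl) ++ t.map (Prod.map Sum.inr Sum.inr))) =
          ((1, 1) :: (swapOf p, 1) :: ((visited (swapOf p) l).map (fun h => (h, swapOf q)) ++
            (visited (swapOf q) t).map (fun h => (1, h)))).map (Perm.sumCongrHom α β) := by
        have e1 := visited_map (swapOf_map_inl (β := β))
          (Perm.sumCongrHom α β (1, swapOf q)) (swapOf p) l
        have e2 := visited_map (swapOf_map_inr (α := α)) 1 (swapOf q) t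
        simp only [MonoidHom.comp_apply, MonoidHom.inl_apply, MonoidHom.inr_apply, ← map_mul,
          Prod.mk_mul_mk, one_mul, mul_one] at e1 e2
        simp only [visited, visited_append, prod_map swapOf_map_inl, swapOf_map_inl,
          swapOf_map_inr, MonoidHom.comp_apply, MonoidHom.inl_apply, MonoidHom.inr_apply,
          ← map_mul, Prod.mk_mul_mk, one_mul, mul_one, hlp, e1, e2]
        simp only [List.map_cons, List.map_append, List.map_map, Function.comp_def]
        rw [show ((1 : Perm α), (1 : Perm β)) = 1 from rfl, map_one]
      rw [key]
      refine List.Nodup.map hinj ?_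
      simp only [List.nodup_cons, List.mem_cons, List.mem_append, List.mem_map, Prod.mk.injEq]
      refine ⟨?_, ?_, List.Nodup.append ?_ ?_ ?_⟩
      · rintro (h | ⟨h, -, -, h2⟩ | ⟨h, h1, -, rfl⟩)
        · exact hp h.1.symm
        · exact hq h2
        · exact htv.1 h1
      · rintro (⟨h, -, -, h2⟩ | ⟨h, -, h1, -⟩)
        · exact hq h2
        · exact hp h1.symm
      · exact hlv.2.map fun u v huv => congrArg Prod.fst huv
      · exact htv.2.map fun u v huv => congrArg Prod.snd huv
      · intro x hx hy
        obtain ⟨u, hu, rfl⟩ := List.mem_map.1 hx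
        obtain ⟨v, hv, huv⟩ := List.mem_map.1 hy
        obtain rfl : 1 = u := congrArg Prod.fst huv
        exact hlv.1 hu

theorem IsRainbowList.exists_add {n m : ℕ} (hn : Even n) (hn0 : 2 ≤ n)
    {l : List (Fin n × Fin n)} {t : List (Fin m × Fin m)} (hl : IsRainbowList l)
    (ht : IsRainbowList t) : ∃ L : List (Fin (n + m) × Fin (n + m)), IsRainbowList L := by
  have hl0 : l ≠ [] := by
    rintro rfl
    have := hl.length
    have := Nat.choose_pos hn0
    simp at *
    omega
  obtain ⟨L, hL, hprod, hv⟩ := hl.exists_merge hl0 ht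
  have hx : ∀ c : Fin n ⊕ Fin m, c ∈ (List.finRange m).map Sum.inr ↔ c.isRight := by
    rintro (c | c) <;> simp
  have hlabel : (L.map label).Perm
      ((l.map label).map (Sym2.map Sum.inl) ++ (t.map label).map (Sym2.map Sum.inr)) := by
    simpa [Function.comp_def, label] using hL.map label
  refine ⟨_, (IsRainbowList.flatMap_expand (σ := Sum.map Fin.rev id)
    (xs := (List.finRange m).map Sum.inr) (l := L)
    ((List.nodup_finRange m).map Sum.inr_injective) ?_ ?_ ?_ ?_ ?_ hprod hv).map_equiv
      finSumFinEquiv⟩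
  · rintro (c | c) <;> simp
  · rintro (c | c)
    · simp only [hx, Sum.map_inl, Sum.inl.injEq, Sum.isRight_inl, Bool.false_eq_true, iff_false,
        Fin.ext_iff, Fin.val_rev]
      obtain ⟨k, rfl⟩ := hn
      omega
    · simp
  · intro p hp
    rw [hL.mem_iff, List.mem_append, List.mem_map, List.mem_map] at hp
    rcases hp with ⟨q, hq, rfl⟩ | ⟨q, hq, rfl⟩
    · simpa using hl.ne hq
    · simpa using ht.ne hq
  · rw [hlabel.nodup_iff]
    refine List.Nodup.append (hl.nodup_label.map (Sym2.map.injective Sum.inl_injective))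
      (ht.nodup_label.map (Sym2.map.injective Sum.inr_injective)) ?_
    intro e he he'
    obtain ⟨e, -, rfl⟩ := List.mem_map.1 he
    obtain ⟨e', -, he'⟩ := List.mem_map.1 he'
    induction e with
    | _ a b =>
      induction e' with
      | _ c d => simp at he'
  · intro a b hab hiff
    simp only [hx] at hiff
    rw [hlabel.mem_iff, List.mem_append]
    rcases a with a | a <;> rcases b with b | b
    · exact Or.inl (List.mem_map.2 ⟨s(a, b), (hl.mem_label_iff _).2 (by simpa using hab), rfl⟩)
    · simp at hiff
    · simp at hiff
    · exact Or.inr (List.mem_map.2 ⟨s(a, b), (ht.mem_label_iff _).2 (by simpa using hab), rfl⟩)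

theorem isRainbowList_nil : IsRainbowList ([] : List (Fin 1 × Fin 1)) := by
  refine ⟨by simp, fun e => ?_, by simp, by simp [visited]⟩
  induction e with
  | _ a b => simp [Subsingleton.elim a b]

theorem isRainbowList_four :
    IsRainbowList ([(0, 1), (0, 2), (1, 3), (0, 3), (1, 2), (2, 3)] : List (Fin 4 × Fin 4)) := by
  refine ⟨by decide, ?_, by decide, by decide⟩
  decide

theorem exists_isRainbowList_four_mul (k : ℕ) (hk : 1 ≤ k) :
    ∃ l : List (Fin (4 * k) × Fin (4 * k)), IsRainbowList l := by
  induction k, hk using Nat.le_induction with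
  | base => exact ⟨_, isRainbowList_four⟩
  | succ k hk ih =>
    obtain ⟨l, hl⟩ := ih
    exact hl.exists_add (n := 4 * k) ⟨2 * k, by ring⟩ (by omega) isRainbowList_four

end RainbowPerm

/-- For every `n ≥ 2` with `⌊n/2⌋` even, the flip graph of permutations of
`{1, …, n}` contains a rainbow cycle; it has length `C(n,2)`. -/
theorem permutations_rainbow_cycle (n : ℕ) (hn : 2 ≤ n) (heven : Even (n / 2)) :
    ∃ V : ℕ → Equiv.Perm (Fin n), IsRainbowCycleP n (n.choose 2) V := by
  obtain ⟨k, hk⟩ := heven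
  obtain ⟨l, hl⟩ := RainbowPerm.exists_isRainbowList_four_mul k (by omega)
  obtain rfl | rfl : n = 4 * k ∨ n = 4 * k + 1 := by omega
  · exact hl.exists_isRainbowCycleP hn
  · obtain ⟨L, hL⟩ := hl.exists_add ⟨2 * k, by ring⟩ (by omega) RainbowPerm.isRainbowList_nil
    exact hL.exists_isRainbowCycleP hn
end

section
/- Let n ≥ 4 be even and let k be an integer with 2 ≤ k ≤ ⌊n/2⌋. Then the flip graph of subsets G_{n,k}^C contains no rainbow cycle. -/
/-! Rainbow cycles in the flip graph of `k`-element subsets of `{1, …, n}`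
(represented by `k`-element Finsets of `Fin n`), where two subsets `A`, `B`
are adjacent if `|A △ B| = 2`, and the corresponding edge is labeled by the
2-element set `A △ B`. -/

/-- A rainbow cycle of length `L` in the flip graph `G_{n,k}^C` of `k`-element
subsets of `{1, …, n}`, encoded as an `L`-periodic sequence `V` of `k`-element
subsets: consecutive subsets differ in exchanging one element for another
(their symmetric difference, the label of the edge, has exactly two elements),
no subset is visited twice within a period, and every one of the `C(n,2)`
possible labels `{x, y}` appears exactly once per period. -/
def IsRainbowCycleC (n k L : ℕ) (V : ℕ → Finset (Fin n)) : Prop :=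
  0 < L ∧
  (∀ i, V (i + L) = V i) ∧
  (∀ i < L, ∀ j < L, V i = V j → i = j) ∧
  (∀ i, (V i).card = k) ∧
  (∀ i, (symmDiff (V i) (V (i + 1))).card = 2) ∧
  (∀ x y : Fin n, x ≠ y →
    ((Finset.range L).filter
      (fun i => symmDiff (V i) (V (i + 1)) = {x, y})).card = 1)

/-- Along a sequence of sets, the number of steps changing the membership of `x` is even iff
the first and last sets agree on `x`. -/
theorem even_card_filter_mem_symmDiff_iff {α : Type*} [DecidableEq α] (V : ℕ → Finset α) (x : α)
    (L : ℕ) :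
    Even ((Finset.range L).filter (fun i => x ∈ symmDiff (V i) (V (i + 1)))).card ↔
      (x ∈ V 0 ↔ x ∈ V L) := by
  induction L with
  | zero => simp
  | succ L ih =>
    rw [Finset.range_add_one, Finset.filter_insert]
    split_ifs with h
    · rw [Finset.card_insert_of_notMem (by simp), Nat.even_add_one, ih]
      rw [Finset.mem_symmDiff] at h
      tauto
    · rw [ih]
      rw [Finset.mem_symmDiff] at h
      tauto

/-- In a rainbow cycle, each element is contained in the labels of exactly `n - 1` edges. -/
theorem IsRainbowCycleC.card_filter_mem_symmDiff {n k L : ℕ} {V : ℕ → Finset (Fin n)}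
    (h : IsRainbowCycleC n k L V) (x : Fin n) :
    ((Finset.range L).filter (fun i => x ∈ symmDiff (V i) (V (i + 1)))).card = n - 1 := by
  obtain ⟨-, -, -, -, htwo, hlabel⟩ := h
  have hunion : (Finset.range L).filter (fun i => x ∈ symmDiff (V i) (V (i + 1))) =
      (Finset.univ.erase x).biUnion (fun y =>
        (Finset.range L).filter (fun i => symmDiff (V i) (V (i + 1)) = {x, y})) := by
    ext i
    simp only [Finset.mem_filter, Finset.mem_biUnion, Finset.mem_erase, Finset.mem_univ, and_true]
    constructor
    · rintro ⟨hi, hx⟩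
      obtain ⟨a, b, hab, heq⟩ := Finset.card_eq_two.mp (htwo i)
      rw [heq, Finset.mem_insert, Finset.mem_singleton] at hx
      rcases hx with rfl | rfl
      · exact ⟨b, hab.symm, hi, heq⟩
      · exact ⟨a, hab, hi, heq.trans (Finset.pair_comm _ _)⟩
    · rintro ⟨y, -, hi, heq⟩
      exact ⟨hi, by simp [heq]⟩
  rw [hunion, Finset.card_biUnion,
    Finset.sum_congr rfl fun y hy => hlabel x y (Finset.ne_of_mem_erase hy).symm]
  · simp
  · intro y hy z hz hyz
    rw [Function.onFun, Finset.disjoint_left]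
    intro i hi hi'
    have heq := (Finset.mem_filter.mp hi).2.symm.trans (Finset.mem_filter.mp hi').2
    have hmem : y ∈ ({x, z} : Finset (Fin n)) := heq ▸ by simp
    simp [Finset.ne_of_mem_erase hy, hyz] at hmem

/-- For every even `n ≥ 4` and every `k` with `2 ≤ k ≤ ⌊n/2⌋`, the flip graph
of `k`-element subsets of `{1, …, n}` contains no rainbow cycle. -/
theorem subsets_no_rainbow_cycle_even (n k : ℕ) (hn : 4 ≤ n) (heven : Even n)
    (hk2 : 2 ≤ k) (hkn : k ≤ n / 2) :
    ¬ ∃ (L : ℕ) (V : ℕ → Finset (Fin n)), IsRainbowCycleC n k L V := by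
  rintro ⟨L, V, h⟩
  have hclosed : V L = V 0 := by simpa using h.2.1 0
  have hcount := (even_card_filter_mem_symmDiff_iff V ⟨0, by omega⟩ L).mpr (by rw [hclosed])
  rw [h.card_filter_mem_symmDiff] at hcount
  grind
end

section
/- Let n ≥ 5 be odd. Then the flip graph G_{n,2}^C of 2-element subsets of [n] contains a rainbow Hamilton cycle, i.e., a rainbow cycle that visits every one of the C(n,2) vertices of G_{n,2}^C exactly once. -/
namespace RainbowSubsets

/-- The signed offsets of the base block: `{0, offset L r}` for `r < L` is the base block, and
`offset L L = 1` describes the first vertex of the block translated by `1`. -/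
def offset (L r : ℕ) : ℤ :=
  if r = L then 1 else if (r % 2 = 0 ↔ r < (L + 1) / 2) then -(r + 1) else r + 1

theorem intCast_eq_zero_of_abs_lt {L : ℕ} {z : ℤ} (h : (z : ZMod (2 * L + 1)) = 0)
    (hz : |z| < 2 * (2 * L + 1)) : z = 0 ∨ z = 2 * L + 1 ∨ z = -(2 * L + 1) := by
  rw [ZMod.intCast_zmod_eq_zero_iff_dvd] at h
  obtain ⟨k, rfl⟩ := h
  push_cast at hz ⊢
  rw [abs_mul, abs_of_nonneg (by positivity), mul_comm] at hz
  have hk : |k| < 2 := lt_of_mul_lt_mul_right hz (by positivity)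
  rw [abs_lt] at hk
  obtain rfl | rfl | rfl : k = 0 ∨ k = 1 ∨ k = -1 := by omega
  all_goals simp

theorem ne_neg_of_ne_zero {L : ℕ} {x : ZMod (2 * L + 1)} (hx : x ≠ 0) : x ≠ -x := by
  intro h
  apply hx
  have h0 : (2 * L + 1 : ZMod (2 * L + 1)) = 0 := by
    exact_mod_cast ZMod.natCast_self (2 * L + 1)
  linear_combination x * h0 - L * h

theorem pair_eq_cases {G : Type*} [AddCommGroup G] [DecidableEq G] {x y d e : G} (hd : d ≠ 0)
    (h : ({x, x + d} : Finset G) = {y, y + e}) : (x = y ∧ d = e) ∨ (d = -e) := by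
  have hx : x ∈ ({y, y + e} : Finset G) := h ▸ by simp
  have hxd : x + d ∈ ({y, y + e} : Finset G) := h ▸ by simp
  simp only [Finset.mem_insert, Finset.mem_singleton] at hx hxd
  grind

theorem choose_two_of_odd (L : ℕ) : (2 * L + 1).choose 2 = (2 * L + 1) * L := by
  rw [Nat.choose_two_right, Nat.add_sub_cancel, mul_left_comm, Nat.mul_div_cancel_left _ two_pos]

theorem translates_injective {L : ℕ} (b e : ℕ → ZMod (2 * L + 1))
    (h0 : ∀ r < L, e r ≠ 0)
    (hinj : ∀ r < L, ∀ s < L, (e r = e s ∨ e r = -e s) → r = s)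
    {i j : ℕ} (hi : i < (2 * L + 1) * L) (hj : j < (2 * L + 1) * L)
    (h : ({(i / L : ℕ) + b (i % L), (i / L : ℕ) + b (i % L) + e (i % L)} :
        Finset (ZMod (2 * L + 1))) =
      {(j / L : ℕ) + b (j % L), (j / L : ℕ) + b (j % L) + e (j % L)}) : i = j := by
  have hL : 0 < L := Nat.pos_of_ne_zero (by rintro rfl; simp at hi)
  have hri := Nat.mod_lt i hL
  have hrj := Nat.mod_lt j hL
  have hr : i % L = j % L := hinj _ hri _ hrj <| by
    rcases pair_eq_cases (h0 _ hri) h with h | h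
    · exact .inl h.2
    · exact .inr h
  rw [hr] at h
  rcases pair_eq_cases (h0 _ hrj) h with h | h
  · have hq := (ZMod.natCast_eq_natCast_iff' _ _ _).1 (add_right_cancel h.1)
    rw [Nat.mod_eq_of_lt (Nat.div_lt_of_lt_mul (by rwa [mul_comm])),
      Nat.mod_eq_of_lt (Nat.div_lt_of_lt_mul (by rwa [mul_comm]))] at hq
    rw [← Nat.div_add_mod i L, ← Nat.div_add_mod j L, hr, hq]
  · exact absurd h (ne_neg_of_ne_zero (h0 _ hrj))

theorem translates_surjective {L : ℕ} (b e : ℕ → ZMod (2 * L + 1))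
    (h0 : ∀ r < L, e r ≠ 0)
    (hinj : ∀ r < L, ∀ s < L, (e r = e s ∨ e r = -e s) → r = s)
    {A : Finset (ZMod (2 * L + 1))} (hA : A.card = 2) :
    ∃ i < (2 * L + 1) * L,
      ({(i / L : ℕ) + b (i % L), (i / L : ℕ) + b (i % L) + e (i % L)} :
        Finset (ZMod (2 * L + 1))) = A := by
  obtain ⟨i, hi, h⟩ := Finset.surj_on_of_inj_on_of_card_le
    (s := Finset.range ((2 * L + 1) * L)) (t := Finset.powersetCard 2 Finset.univ)
    (fun i _ => ({(i / L : ℕ) + b (i % L), (i / L : ℕ) + b (i % L) + e (i % L)} :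
        Finset (ZMod (2 * L + 1))))
    (fun i hi => by
      have hL : 0 < L := Nat.pos_of_ne_zero (by rintro rfl; simp at hi)
      simpa [Finset.mem_powersetCard] using
        Finset.card_pair (by simpa using (h0 _ (Nat.mod_lt i hL))))
    (fun i j hi hj h => translates_injective b e h0 hinj
      (Finset.mem_range.1 hi) (Finset.mem_range.1 hj) h)
    (by simp [Finset.card_powersetCard, ZMod.card, choose_two_of_odd]) A
    (by simpa [Finset.mem_powersetCard] using hA)
  exact ⟨i, Finset.mem_range.1 hi, h.symm⟩

theorem offset_ne_zero {L r : ℕ} (hr : r ≤ L) (hL : 2 ≤ L) :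
    (offset L r : ZMod (2 * L + 1)) ≠ 0 := by
  intro h
  have := intCast_eq_zero_of_abs_lt h (by rw [abs_lt]; unfold offset; split_ifs <;> omega)
  unfold offset at this
  split_ifs at this <;> omega

theorem offset_injective {L r s : ℕ} (hr : r < L) (hs : s < L)
    (h : (offset L r : ZMod (2 * L + 1)) = offset L s ∨
      (offset L r : ZMod (2 * L + 1)) = -offset L s) : r = s := by
  rcases h with h | h
  · have := intCast_eq_zero_of_abs_lt (L := L) (z := offset L r - offset L s) (by simp [h])
      (by rw [abs_lt]; unfold offset; split_ifs <;> omega)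
    unfold offset at this
    split_ifs at this <;> omega
  · have := intCast_eq_zero_of_abs_lt (L := L) (z := offset L r + offset L s) (by simp [h])
      (by rw [abs_lt]; unfold offset; split_ifs <;> omega)
    unfold offset at this
    split_ifs at this <;> omega

/-- The difference of consecutive offsets, up to sign. -/
theorem offset_step {L r : ℕ} (hL : 2 ≤ L) (hr : r < L) :
    ∃ c : ℤ, (offset L (r + 1) - offset L r = c ∨ offset L (r + 1) - offset L r = -c) ∧
      ((r + 1 = L ∧ L % 2 = 0 ∧ c = L + 1) ∨ (r + 1 = L ∧ L % 2 = 1 ∧ c = L - 1) ∨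
       (r + 1 < L ∧ r + 1 = (L + 1) / 2 ∧ c = 1) ∨
       (r + 1 < L ∧ r + 1 ≠ (L + 1) / 2 ∧ c = 2 * r + 3)) := by
  rcases Nat.lt_or_ge (r + 1) L with h | h
  · by_cases h' : r + 1 = (L + 1) / 2
    · refine ⟨1, ?_, by omega⟩
      unfold offset
      split_ifs <;> omega
    · refine ⟨2 * r + 3, ?_, by omega⟩
      unfold offset
      split_ifs <;> omega
  · rcases Nat.mod_two_eq_zero_or_one L with h' | h'
    · refine ⟨L + 1, ?_, by omega⟩
      unfold offset
      split_ifs <;> omega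
    · refine ⟨L - 1, ?_, by omega⟩
      unfold offset
      split_ifs <;> omega

theorem offset_step_ne_zero {L r : ℕ} (hL : 2 ≤ L) (hr : r < L) :
    ((offset L (r + 1) - offset L r : ℤ) : ZMod (2 * L + 1)) ≠ 0 := by
  intro h
  obtain ⟨c, hc, hc'⟩ := offset_step hL hr
  have := intCast_eq_zero_of_abs_lt h (by rw [abs_lt]; omega)
  omega

theorem offset_step_injective {L r s : ℕ} (hL : 2 ≤ L) (hr : r < L) (hs : s < L)
    (h : ((offset L (r + 1) - offset L r : ℤ) : ZMod (2 * L + 1)) =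
        (offset L (s + 1) - offset L s : ℤ) ∨
      ((offset L (r + 1) - offset L r : ℤ) : ZMod (2 * L + 1)) =
        -(offset L (s + 1) - offset L s : ℤ)) : r = s := by
  obtain ⟨c, hc, hc'⟩ := offset_step hL hr
  obtain ⟨d, hd, hd'⟩ := offset_step hL hs
  generalize offset L (r + 1) - offset L r = x at *
  generalize offset L (s + 1) - offset L s = y at *
  rcases h with h | h
  · have := intCast_eq_zero_of_abs_lt (L := L) (z := x - y) (by simp [h]) (by rw [abs_lt]; omega)
    omega
  · have := intCast_eq_zero_of_abs_lt (L := L) (z := x + y) (by simp [h]) (by rw [abs_lt]; omega)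
    omega

/-- The vertex sequence: the base block, translated by `1` after every `L` steps. -/
def vertex (L i : ℕ) : Finset (ZMod (2 * L + 1)) :=
  {((i / L : ℕ) : ZMod (2 * L + 1)), ((i / L : ℕ) : ZMod (2 * L + 1)) + offset L (i % L)}

theorem vertex_add_one {L : ℕ} (hL : 2 ≤ L) (i : ℕ) :
    vertex L (i + 1) = {((i / L : ℕ) : ZMod (2 * L + 1)),
      ((i / L : ℕ) : ZMod (2 * L + 1)) + offset L (i % L + 1)} := by
  have hr := Nat.mod_lt i (show 0 < L by omega)
  have hi := Nat.div_add_mod i L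
  rcases Nat.lt_or_ge (i % L + 1) L with h | h
  · have h1 : (i + 1) / L = i / L ∧ (i + 1) % L = i % L + 1 :=
      (Nat.div_mod_unique (by omega)).2 ⟨by omega, h⟩
    simp only [vertex, h1]
  · have h1 : (i + 1) / L = i / L + 1 ∧ (i + 1) % L = 0 :=
      (Nat.div_mod_unique (by omega)).2 ⟨by rw [mul_add]; omega, by omega⟩
    have h2 : i % L + 1 = L := by omega
    have h3 : offset L 0 = -1 := by unfold offset; split_ifs <;> omega
    have h4 : offset L L = 1 := if_pos rfl
    simp only [vertex, h1, h2, h3, h4]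
    push_cast
    rw [add_neg_cancel_right, Finset.pair_comm]

theorem symmDiff_pair {G : Type*} [DecidableEq G] {x y z : G} (hy : x ≠ y) (hz : x ≠ z)
    (hyz : y ≠ z) : symmDiff ({x, y} : Finset G) {x, z} = {y, z} := by
  ext w
  simp only [Finset.mem_symmDiff, Finset.mem_insert, Finset.mem_singleton]
  grind

theorem symmDiff_vertex {L : ℕ} (hL : 2 ≤ L) (i : ℕ) :
    symmDiff (vertex L i) (vertex L (i + 1)) =
      {((i / L : ℕ) : ZMod (2 * L + 1)) + offset L (i % L),
       ((i / L : ℕ) : ZMod (2 * L + 1)) + offset L (i % L) +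
        (offset L (i % L + 1) - offset L (i % L) : ℤ)} := by
  have hr := Nat.mod_lt i (show 0 < L by omega)
  have h1 := offset_ne_zero hr.le hL
  have h2 := offset_ne_zero (show i % L + 1 ≤ L from hr) hL
  have h3 := offset_step_ne_zero hL hr
  push_cast at h3 ⊢
  rw [vertex_add_one hL, vertex, symmDiff_pair (by simpa using h1) (by simpa using h2)
    (fun h => h3 (sub_eq_zero.2 (add_left_cancel h).symm))]
  congr 2
  abel

theorem vertex_periodic {L : ℕ} (hL : 2 ≤ L) (i : ℕ) :
    vertex L (i + (2 * L + 1) * L) = vertex L i := by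
  have h : ((2 * L + 1 : ℕ) : ZMod (2 * L + 1)) = 0 := ZMod.natCast_self _
  rw [vertex, Nat.add_mul_div_right _ _ (by omega), Nat.add_mul_mod_self_right, Nat.cast_add, h,
    add_zero, vertex]

end RainbowSubsets

open RainbowSubsets

/-- For every odd `n ≥ 5`, the flip graph of 2-element subsets of `{1, …, n}`
contains a rainbow Hamilton cycle: a rainbow cycle of length `C(n,2)` that
visits every one of the `C(n,2)` vertices (exactly once). -/
theorem subsets_rainbow_hamilton_cycle (n : ℕ) (hn : 5 ≤ n) (hodd : Odd n) :
    ∃ V : ℕ → Finset (Fin n), IsRainbowCycleC n 2 (n.choose 2) V ∧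
      ∀ A : Finset (Fin n), A.card = 2 → ∃ i < n.choose 2, V i = A := by
  obtain ⟨L, rfl⟩ := hodd
  have hL : 2 ≤ L := by omega
  rw [choose_two_of_odd]
  have hsurj : ∀ A : Finset (ZMod (2 * L + 1)), A.card = 2 →
      ∃ i < (2 * L + 1) * L, vertex L i = A := fun A hA => by
    simpa [vertex] using translates_surjective 0 (fun r => (offset L r : ZMod (2 * L + 1)))
      (fun r hr => offset_ne_zero hr.le hL) (fun r hr s hs => offset_injective hr hs) hA
  have hinj : ∀ i < (2 * L + 1) * L, ∀ j < (2 * L + 1) * L, vertex L i = vertex L j → i = j :=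
    fun i hi j hj h => translates_injective 0 (fun r => (offset L r : ZMod (2 * L + 1)))
      (fun r hr => offset_ne_zero hr.le hL) (fun r hr s hs => offset_injective hr hs) hi hj
      (by simpa [vertex] using h)
  have hvcard : ∀ i, (vertex L i).card = 2 := fun i => Finset.card_pair <| by
    simpa using offset_ne_zero (Nat.mod_lt i (show 0 < L by omega)).le hL
  have hlcard : ∀ i, (symmDiff (vertex L i) (vertex L (i + 1))).card = 2 := fun i => by
    rw [symmDiff_vertex hL]
    exact Finset.card_pair <| by
      simpa only [ne_eq, left_eq_add] using
        offset_step_ne_zero hL (Nat.mod_lt i (show 0 < L by omega))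
  have hlabel : ∀ x y : ZMod (2 * L + 1), x ≠ y → ((Finset.range ((2 * L + 1) * L)).filter
      (fun i => symmDiff (vertex L i) (vertex L (i + 1)) = {x, y})).card = 1 := by
    intro x y hxy
    have h0 := fun r (hr : r < L) => offset_step_ne_zero hL hr
    have h1 := fun r (hr : r < L) s (hs : s < L) => offset_step_injective hL hr hs
    obtain ⟨i, hi, h⟩ := translates_surjective (fun r => (offset L r : ZMod (2 * L + 1)))
      (fun r => ((offset L (r + 1) - offset L r : ℤ) : ZMod (2 * L + 1))) h0 h1
      (Finset.card_pair hxy)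
    rw [Finset.card_eq_one]
    refine ⟨i, Finset.ext fun j => ?_⟩
    rw [Finset.mem_filter, Finset.mem_range, Finset.mem_singleton, symmDiff_vertex hL]
    constructor
    · rintro ⟨hj, hj'⟩
      exact translates_injective (fun r => (offset L r : ZMod (2 * L + 1)))
        (fun r => ((offset L (r + 1) - offset L r : ℤ) : ZMod (2 * L + 1))) h0 h1 hj hi
        (hj'.trans h.symm)
    · rintro rfl
      exact ⟨hi, h⟩
  exact ⟨vertex L, ⟨by positivity, vertex_periodic hL, hinj, hvcard, hlcard, hlabel⟩, hsurj⟩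
end

section
/- Let n be odd and let k be an integer with 3 ≤ k < n/3. Then the flip graph of subsets G_{n,k}^C contains a rainbow cycle, i.e., a cycle of length C(n,2) visiting no k-element subset twice along which each of the C(n,2) pairs {x,y} ⊆ [n] appears exactly once as an edge label. -/
section Helpers

open scoped Pointwise

/-- `a` is a walk in `{0, …, m}` from `m` to `0` with `l` steps, not repeating a vertex, such that
every cyclic distance modulo `2 * l + 1` is realised at most once: `D i` is the cyclic distance
covered by the `i`-th step. -/
structure IsGracefulWalk (l m : ℕ) (a D : ℕ → ℕ) : Prop where
  start : a 0 = m
  finish : a l = 0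
  le : ∀ i ≤ l, a i ≤ m
  pos : ∀ i < l, 0 < a i
  inj : ∀ i < l, ∀ j < l, a i = a j → i = j
  dist_pos : ∀ i < l, 0 < D i
  dist_le : ∀ i < l, D i ≤ l
  dist_inj : ∀ i < l, ∀ j < l, D i = D j → i = j
  step : ∀ i < l, a i + D i = a (i + 1) ∨ a (i + 1) + D i = a i ∨
    a i + D i = a (i + 1) + (2 * l + 1) ∨ a (i + 1) + D i = a i + (2 * l + 1)

/-- A zigzag from `m` that skips the step of length `d`, whose first step has length `l + f`, and
which jumps to `0` at the end. -/
def zigzag (l m f d i : ℕ) : ℕ :=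
  if i = 0 then m else if l ≤ i then 0 else if i % 2 = 1 then m - l - f + i / 2
  else if i < l - d then m - f - i / 2 else m - f - i / 2 - 1

/-- The cyclic distances covered by the steps of `zigzag`. -/
def zigzagDist (l d i : ℕ) : ℕ :=
  if i < l - d then l - i else if i + 1 < l then l - i - 1 else d

lemma isGracefulWalk_zigzag {l m f d : ℕ} (hm : l + 3 ≤ m) (hf : f ≤ 1) (hd : 0 < d) (hdl : d < l)
    (hpar : (l - d) % 2 = 1)
    (hq : m = d + l / 2 + 1 + f ∨ m + d = 2 * l + 1 + l / 2 + 1 + f) :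
    IsGracefulWalk l m (zigzag l m f d) (zigzagDist l d) where
  start := by simp [zigzag]
  finish := by unfold zigzag; split_ifs <;> omega
  le i hi := by unfold zigzag; split_ifs <;> omega
  pos i hi := by unfold zigzag; split_ifs <;> omega
  inj i hi j hj h := by unfold zigzag at h; split_ifs at h <;> omega
  dist_pos i hi := by unfold zigzagDist; split_ifs <;> omega
  dist_le i hi := by unfold zigzagDist; split_ifs <;> omega
  dist_inj i hi j hj h := by unfold zigzagDist at h; split_ifs at h <;> omega
  step i hi := by unfold zigzag zigzagDist; split_ifs <;> first | contradiction | omega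

/-- A zigzag from `m` that skips the steps of length `l - 1` and `2`, which are used at the end, to
jump to `2` and then to `0`. -/
def shortZigzag (l m i : ℕ) : ℕ :=
  if i = 0 then m else if l ≤ i then 0 else if i + 1 = l then 2 else if i + 2 = l then l + 1
  else if i % 2 = 1 then m - l + i / 2 else m - i / 2 - 1

/-- The cyclic distances covered by the steps of `shortZigzag`. -/
def shortZigzagDist (l i : ℕ) : ℕ :=
  if i = 0 then l else if i + 1 = l then 2 else if i + 2 = l then l - 1
  else if i + 3 = l then 1 else l - i - 1

lemma isGracefulWalk_shortZigzag {l m : ℕ} (hl : 5 ≤ l) (hm : m = l + 2 + l / 2) :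
    IsGracefulWalk l m (shortZigzag l m) (shortZigzagDist l) where
  start := by simp [shortZigzag]
  finish := by unfold shortZigzag; split_ifs <;> omega
  le i hi := by unfold shortZigzag; split_ifs <;> omega
  pos i hi := by unfold shortZigzag; split_ifs <;> omega
  inj i hi j hj h := by unfold shortZigzag at h; split_ifs at h <;> omega
  dist_pos i hi := by unfold shortZigzagDist; split_ifs <;> omega
  dist_le i hi := by unfold shortZigzagDist; split_ifs <;> omega
  dist_inj i hi j hj h := by unfold shortZigzagDist at h; split_ifs at h <;> omega
  step i hi := by unfold shortZigzag shortZigzagDist; split_ifs <;> first | contradiction | omega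

lemma exists_isGracefulWalk {l m : ℕ} (hl : 5 ≤ l) (hm : l + 3 ≤ m) (hml : m < 2 * l) :
    ∃ a D, IsGracefulWalk l m a D := by
  by_cases hex : m = l + 2 + l / 2
  · exact ⟨_, _, isGracefulWalk_shortZigzag hl hex⟩
  obtain ⟨f, d, hf, hd, hdl, hpar, hq⟩ : ∃ f d, f ≤ 1 ∧ 0 < d ∧ d < l ∧ (l - d) % 2 = 1 ∧
      (m = d + l / 2 + 1 + f ∨ m + d = 2 * l + 1 + l / 2 + 1 + f) := by
    by_cases hlow : m < l + 2 + l / 2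
    · by_cases hpar : (m - l / 2 - 1 + l) % 2 = 1
      · exact ⟨0, m - l / 2 - 1, by omega⟩
      · exact ⟨1, m - l / 2 - 2, by omega⟩
    · by_cases hpar : (2 * l + 1 + l / 2 + 1 - m + l) % 2 = 1
      · exact ⟨0, 2 * l + 1 + l / 2 + 1 - m, by omega⟩
      · exact ⟨1, 2 * l + 1 + l / 2 + 2 - m, by omega⟩
  exact ⟨_, _, isGracefulWalk_zigzag hm hf hd hdl hpar hq⟩

/-- The subset of `ZMod n` consisting of the residues of `z` and of `m + 1, …, n - 1`. -/
def block (n m z : ℕ) : Finset (ZMod n) :=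
  insert (z : ZMod n) ((Finset.Ioo m n).image Nat.cast)

section Block

variable {n m : ℕ}

lemma natCast_mem_block {z v : ℕ} (hv : v < n) (hz : z < n) :
    (v : ZMod n) ∈ block n m z ↔ v = z ∨ m < v := by
  have key : ∀ w < n, (v : ZMod n) = w ↔ v = w := fun w hw => by
    rw [ZMod.natCast_eq_natCast_iff', Nat.mod_eq_of_lt hv, Nat.mod_eq_of_lt hw]
  simp only [block, Finset.mem_insert, Finset.mem_image, Finset.mem_Ioo, key z hz]
  refine or_congr_right ⟨?_, fun h => ⟨v, ⟨h, hv⟩, rfl⟩⟩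
  rintro ⟨w, ⟨hmw, hwn⟩, hw⟩
  rwa [(key w hwn).1 hw.symm]

lemma eq_of_subset_natCast [NeZero n] {A B : Finset (ZMod n)}
    (h : ∀ v < n, ((v : ZMod n) ∈ A ↔ (v : ZMod n) ∈ B)) : A = B := by
  ext x
  simpa using h x.val x.val_lt

lemma natCast_notMem_image_Ioo {z : ℕ} (hz : z ≤ m) (hm : m < n) :
    (z : ZMod n) ∉ (Finset.Ioo m n).image (Nat.cast : ℕ → ZMod n) := by
  simp only [Finset.mem_image, Finset.mem_Ioo, not_exists, not_and]
  rintro w ⟨hmw, hwn⟩ h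
  rw [ZMod.natCast_eq_natCast_iff', Nat.mod_eq_of_lt hwn, Nat.mod_eq_of_lt (by omega)] at h
  omega

lemma card_block {z : ℕ} (hz : z ≤ m) (hm : m < n) : (block n m z).card = n - m := by
  rw [block, Finset.card_insert_of_notMem (natCast_notMem_image_Ioo hz hm),
    Finset.card_image_of_injOn, Nat.card_Ioo]
  · omega
  · intro v hv w hw h
    simp only [Finset.coe_Ioo, Set.mem_Ioo] at hv hw
    simpa [ZMod.natCast_eq_natCast_iff', Nat.mod_eq_of_lt hv.2, Nat.mod_eq_of_lt hw.2] using h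

lemma symmDiff_block [NeZero n] {z w : ℕ} (hz : z ≤ m) (hw : w ≤ m) (hzw : z ≠ w) (hm : m < n) :
    symmDiff (block n m z) (block n m w) = {(z : ZMod n), (w : ZMod n)} := by
  refine eq_of_subset_natCast fun v hv => ?_
  have key : ∀ u < n, (v : ZMod n) = u ↔ v = u := fun u hu => by
    rw [ZMod.natCast_eq_natCast_iff', Nat.mod_eq_of_lt hv, Nat.mod_eq_of_lt hu]
  rw [Finset.mem_symmDiff, natCast_mem_block hv (by omega), natCast_mem_block hv (by omega),
    Finset.mem_insert, Finset.mem_singleton, key z (by omega), key w (by omega)]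
  omega

lemma one_vadd_block [NeZero n] (hm : m < n) : (1 : ZMod n) +ᵥ block n m m = block n m 0 := by
  refine eq_of_subset_natCast fun v hv => ?_
  rw [natCast_mem_block hv (by omega), ← Finset.neg_vadd_mem_iff, vadd_eq_add]
  rcases Nat.eq_zero_or_pos v with rfl | hpos
  · have : (-1 + ((0 : ℕ) : ZMod n)) = ((n - 1 : ℕ) : ZMod n) := by
      rw [Nat.cast_sub (by omega)]; simp
    rw [this, natCast_mem_block (by omega) hm]
    omega
  · have : (-1 + (v : ZMod n)) = ((v - 1 : ℕ) : ZMod n) := by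
      rw [Nat.cast_sub hpos]; push_cast; ring
    rw [this, natCast_mem_block (by omega) hm]
    omega

lemma end_of_run_block_iff [NeZero n] {z : ℕ} (hz : 0 < z) (hzm : z ≤ m) (hm : m + 3 ≤ n)
    (x : ZMod n) :
    (x ∈ block n m z ∧ x + 1 ∈ block n m z ∧ x + 2 ∉ block n m z) ↔ x = -2 := by
  obtain ⟨v, hv, rfl⟩ : ∃ v < n, (v : ZMod n) = x := ⟨x.val, x.val_lt, by simp⟩
  have e : (-2 : ZMod n) = ((n - 2 : ℕ) : ZMod n) := by
    rw [Nat.cast_sub (by omega)]; simp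
  have e1 : (v : ZMod n) + 1 = ((v + 1 : ℕ) : ZMod n) := by push_cast; rfl
  have e2 : (v : ZMod n) + 2 = ((v + 2 : ℕ) : ZMod n) := by push_cast; rfl
  rw [e, ZMod.natCast_eq_natCast_iff', Nat.mod_eq_of_lt hv, Nat.mod_eq_of_lt (by omega), e1, e2,
    natCast_mem_block hv (by omega)]
  rcases (by omega : v + 2 < n ∨ v + 2 = n ∨ v + 1 = n) with h | h | h
  · rw [natCast_mem_block (by omega) (by omega), natCast_mem_block h (by omega)]
    omega
  · rw [natCast_mem_block (by omega) (by omega), h,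
      show ((n : ℕ) : ZMod n) = (0 : ℕ) by simp, natCast_mem_block (by omega) (by omega)]
    omega
  · rw [h, show ((n : ℕ) : ZMod n) = (0 : ℕ) by simp, natCast_mem_block (by omega) (by omega)]
    omega

lemma vadd_block_inj [NeZero n] {z w : ℕ} {r s : ZMod n} (hz : 0 < z) (hzm : z ≤ m) (hw : 0 < w)
    (hwm : w ≤ m) (hm : m + 3 ≤ n) (h : r +ᵥ block n m z = s +ᵥ block n m w) :
    r = s ∧ z = w := by
  have hmem : ∀ x, -r + x ∈ block n m z ↔ -s + x ∈ block n m w := fun x => by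
    rw [← vadd_eq_add, ← vadd_eq_add, Finset.neg_vadd_mem_iff, Finset.neg_vadd_mem_iff, h]
  have hrs : r = s := by
    have h1 := (end_of_run_block_iff hz hzm hm (-r + (r - 2))).2 (by ring)
    have h2 := (end_of_run_block_iff hw hwm hm (-s + (r - 2))).1 (by
      simpa only [add_assoc, hmem] using h1)
    linear_combination h2
  refine ⟨hrs, ?_⟩
  subst hrs
  have h3 := (hmem (r + z)).1 (by simp [block])
  rw [neg_add_cancel_left, natCast_mem_block (by omega) (by omega)] at h3
  omega

end Block

namespace IsGracefulWalk

variable {l m : ℕ} {a D : ℕ → ℕ}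

lemma apply_ne_apply_succ (h : IsGracefulWalk l m a D) {i : ℕ} (hi : i < l) :
    a i ≠ a (i + 1) := by
  have := h.step i hi
  have := h.dist_pos i hi
  have := h.dist_le i hi
  omega

lemma sub_eq_or (h : IsGracefulWalk l m a D) {i : ℕ} (hi : i < l) :
    (a i : ZMod (2 * l + 1)) - a (i + 1) = D i ∨ (a i : ZMod (2 * l + 1)) - a (i + 1) = -D i := by
  have key : ∀ {x y z w : ℕ}, x + y = z + w → (x : ZMod (2 * l + 1)) + y = z + w := by
    intro x y z w hx; exact_mod_cast congrArg (Nat.cast : ℕ → ZMod (2 * l + 1)) hx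
  have hn : ((2 * l + 1 : ℕ) : ZMod (2 * l + 1)) = 0 := ZMod.natCast_self _
  rcases h.step i hi with e | e | e | e
  · right; have := key (e.trans (add_zero _).symm); push_cast at this; linear_combination this
  · left; have := key (e.trans (add_zero _).symm); push_cast at this; linear_combination -this
  · right; have := key e; linear_combination this + hn
  · left; have := key e; linear_combination -this - hn

lemma natCast_add_natCast_ne_zero {l x y : ℕ} (hx : 0 < x) (hxl : x ≤ l) (hyl : y ≤ l) :
    (x : ZMod (2 * l + 1)) + y ≠ 0 := by
  rw [← Nat.cast_add, Ne, ZMod.natCast_eq_zero_iff]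
  exact Nat.not_dvd_of_pos_of_lt (by omega) (by omega)

lemma label_inj (h : IsGracefulWalk l m a D) {i j : ℕ} (hi : i < l) (hj : j < l)
    {r s : ZMod (2 * l + 1)}
    (he : ({r + a i, r + a (i + 1)} : Finset (ZMod (2 * l + 1))) = {s + a j, s + a (j + 1)}) :
    i = j ∧ r = s := by
  have hDi := h.dist_pos i hi
  have hDj := h.dist_pos j hj
  have hli := h.dist_le i hi
  have hlj := h.dist_le j hj
  have hsum := natCast_add_natCast_ne_zero hDi hli hlj
  have hii := natCast_add_natCast_ne_zero hDi hli hli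
  have hcases : (r + a i = s + a j ∧ r + a (i + 1) = s + a (j + 1)) ∨
      (r + a i = s + a (j + 1) ∧ r + a (i + 1) = s + a j) := by
    have := congrArg (fun A : Finset (ZMod (2 * l + 1)) => (A : Set (ZMod (2 * l + 1)))) he
    simpa [Set.pair_eq_pair_iff] using this
  have hD : (D i : ZMod (2 * l + 1)) = D j := by
    rcases hcases with ⟨h1, h2⟩ | ⟨h1, h2⟩ <;> rcases h.sub_eq_or hi with h3 | h3 <;>
      rcases h.sub_eq_or hj with h4 | h4 <;>
      first
      | linear_combination h1 - h2 - h3 + h4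
      | linear_combination -h1 + h2 + h3 - h4
      | linear_combination h1 - h2 - h3 - h4
      | linear_combination -h1 + h2 + h3 + h4
      | exact absurd (by linear_combination h1 - h2 - h3 + h4) hsum
      | exact absurd (by linear_combination -h1 + h2 + h3 - h4) hsum
      | exact absurd (by linear_combination h1 - h2 - h3 - h4) hsum
      | exact absurd (by linear_combination -h1 + h2 + h3 + h4) hsum
  have hij : i = j := by
    rw [ZMod.natCast_eq_natCast_iff', Nat.mod_eq_of_lt (by omega), Nat.mod_eq_of_lt (by omega)]
      at hD
    exact h.dist_inj i hi j hj hD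
  subst hij
  refine ⟨rfl, ?_⟩
  rcases hcases with ⟨h1, -⟩ | ⟨h1, h2⟩
  · exact add_right_cancel h1
  · rcases h.sub_eq_or hi with h3 | h3
    · exact absurd (by linear_combination h1 - h2 - 2 * h3) hii
    · exact absurd (by linear_combination -h1 + h2 + 2 * h3) hii

/-- The blocks along the walk, followed by all their translates. -/
def vertex (l m : ℕ) (a : ℕ → ℕ) (t : ℕ) : Finset (ZMod (2 * l + 1)) :=
  ((t / l : ℕ) : ZMod (2 * l + 1)) +ᵥ block (2 * l + 1) m (a (t % l))

lemma vertex_succ (h : IsGracefulWalk l m a D) (hl : 0 < l) (hm : m < 2 * l + 1) (t : ℕ) :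
    vertex l m a (t + 1) =
      ((t / l : ℕ) : ZMod (2 * l + 1)) +ᵥ block (2 * l + 1) m (a (t % l + 1)) := by
  have hlt := Nat.mod_lt t hl
  have ht : t + 1 = t % l + 1 + l * (t / l) := by have := Nat.mod_add_div t l; omega
  rw [vertex]
  rcases Nat.lt_or_ge (t % l + 1) l with hi | hi
  · have h1 : (t + 1) % l = t % l + 1 := by
      rw [ht, Nat.add_mul_mod_self_left, Nat.mod_eq_of_lt hi]
    have h2 : (t + 1) / l = t / l := by
      conv_lhs => rw [ht]
      rw [Nat.add_mul_div_left _ _ hl, Nat.div_eq_of_lt hi, zero_add]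
    rw [h1, h2]
  · have hi' : t % l + 1 = l := by omega
    have h1 : (t + 1) % l = 0 := by
      rw [ht, hi', Nat.add_mul_mod_self_left, Nat.mod_self]
    have h2 : (t + 1) / l = t / l + 1 := by
      conv_lhs => rw [ht, hi']
      rw [Nat.add_mul_div_left _ _ hl, Nat.div_self hl, add_comm]
    rw [h1, h2, hi', h.start, h.finish, ← one_vadd_block hm, vadd_vadd, Nat.cast_add,
      Nat.cast_one]

lemma symmDiff_vertex (h : IsGracefulWalk l m a D) (hl : 0 < l) (hm : m < 2 * l + 1) (t : ℕ) :
    symmDiff (vertex l m a t) (vertex l m a (t + 1)) =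
      {((t / l : ℕ) : ZMod (2 * l + 1)) + a (t % l),
        ((t / l : ℕ) : ZMod (2 * l + 1)) + a (t % l + 1)} := by
  have hlt := Nat.mod_lt t hl
  rw [h.vertex_succ hl hm, vertex, ← Finset.vadd_finset_symmDiff,
    symmDiff_block (h.le _ hlt.le) (h.le _ hlt) (h.apply_ne_apply_succ hlt) hm]
  simp [Finset.vadd_finset_insert]

lemma card_symmDiff_vertex (h : IsGracefulWalk l m a D) (hl : 0 < l) (hm : m < 2 * l + 1)
    (t : ℕ) : (symmDiff (vertex l m a t) (vertex l m a (t + 1))).card = 2 := by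
  have hlt := Nat.mod_lt t hl
  rw [h.symmDiff_vertex hl hm, Finset.card_pair]
  intro he
  have h1 := h.le _ hlt.le
  have h2 := h.le (t % l + 1) (Nat.succ_le_of_lt hlt)
  replace he := add_left_cancel he
  rw [ZMod.natCast_eq_natCast_iff', Nat.mod_eq_of_lt (h1.trans_lt hm),
    Nat.mod_eq_of_lt (h2.trans_lt hm)] at he
  exact h.apply_ne_apply_succ hlt he

lemma eq_of_mod_eq_of_cast_div_eq (hl : 0 < l) {s t : ℕ} (hs : s < (2 * l + 1) * l)
    (ht : t < (2 * l + 1) * l) (hmod : s % l = t % l)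
    (hdiv : ((s / l : ℕ) : ZMod (2 * l + 1)) = (t / l : ℕ)) : s = t := by
  rw [ZMod.natCast_eq_natCast_iff', Nat.mod_eq_of_lt ((Nat.div_lt_iff_lt_mul hl).2 hs),
    Nat.mod_eq_of_lt ((Nat.div_lt_iff_lt_mul hl).2 ht)] at hdiv
  rw [← Nat.mod_add_div s l, ← Nat.mod_add_div t l, hmod, hdiv]

lemma injOn_label (h : IsGracefulWalk l m a D) (hl : 0 < l) (hm : m < 2 * l + 1) :
    Set.InjOn (fun t => symmDiff (vertex l m a t) (vertex l m a (t + 1)))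
      (Finset.range ((2 * l + 1) * l)) := by
  intro s hs t ht he
  simp only [Finset.coe_range, Set.mem_Iio] at hs ht
  simp only [h.symmDiff_vertex hl hm] at he
  obtain ⟨h1, h2⟩ := h.label_inj (Nat.mod_lt s hl) (Nat.mod_lt t hl) he
  exact eq_of_mod_eq_of_cast_div_eq hl hs ht h1 h2

lemma choose_two (l : ℕ) : (2 * l + 1).choose 2 = (2 * l + 1) * l := by
  rw [Nat.choose_two_right, Nat.add_sub_cancel, show (2 * l + 1) * (2 * l) = (2 * l + 1) * l * 2 by
    ring, Nat.mul_div_cancel _ (by norm_num)]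

lemma card_filter_label (h : IsGracefulWalk l m a D) (hl : 0 < l) (hm : m < 2 * l + 1)
    {x y : ZMod (2 * l + 1)} (hxy : x ≠ y) :
    ((Finset.range ((2 * l + 1) * l)).filter
      (fun t => symmDiff (vertex l m a t) (vertex l m a (t + 1)) = {x, y})).card = 1 := by
  have himage : (Finset.range ((2 * l + 1) * l)).image
      (fun t => symmDiff (vertex l m a t) (vertex l m a (t + 1))) =
      Finset.powersetCard 2 Finset.univ := by
    refine Finset.eq_of_subset_of_card_le ?_ ?_
    · intro A hA
      obtain ⟨t, -, rfl⟩ := Finset.mem_image.1 hA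
      exact Finset.mem_powersetCard.2 ⟨Finset.subset_univ _, h.card_symmDiff_vertex hl hm t⟩
    · rw [Finset.card_image_of_injOn (h.injOn_label hl hm), Finset.card_powersetCard,
        Finset.card_univ, ZMod.card, choose_two, Finset.card_range]
  have hmem : {x, y} ∈ Finset.powersetCard 2 (Finset.univ : Finset (ZMod (2 * l + 1))) :=
    Finset.mem_powersetCard.2 ⟨Finset.subset_univ _, Finset.card_pair hxy⟩
  rw [← himage] at hmem
  obtain ⟨t, ht, he⟩ := Finset.mem_image.1 hmem
  refine Finset.card_eq_one.2 ⟨t, ?_⟩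
  ext s
  rw [Finset.mem_filter, Finset.mem_singleton]
  refine ⟨fun hs => h.injOn_label hl hm hs.1 ht (hs.2.trans he.symm), ?_⟩
  rintro rfl
  exact ⟨ht, he⟩

lemma isRainbowCycleC (h : IsGracefulWalk l m a D) (hl : 0 < l) (hm : m + 3 ≤ 2 * l + 1) :
    IsRainbowCycleC (2 * l + 1) (2 * l + 1 - m) ((2 * l + 1).choose 2) (vertex l m a) := by
  rw [choose_two]
  refine ⟨by positivity, fun t => ?_, fun s hs t ht he => ?_, fun t => ?_,
    h.card_symmDiff_vertex hl (by omega), fun x y hxy => h.card_filter_label hl (by omega) hxy⟩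
  · have hn : ((2 * l + 1 : ℕ) : ZMod (2 * l + 1)) = 0 := ZMod.natCast_self _
    change vertex l m a _ = vertex l m a _
    rw [vertex, vertex, Nat.add_mul_mod_self_right, Nat.add_mul_div_right _ _ hl, Nat.cast_add, hn,
      add_zero]
  · have hs' := Nat.mod_lt s hl
    have ht' := Nat.mod_lt t hl
    obtain ⟨h1, h2⟩ := vadd_block_inj (h.pos _ hs') (h.le _ hs'.le) (h.pos _ ht') (h.le _ ht'.le)
      hm he
    exact eq_of_mod_eq_of_cast_div_eq hl hs ht (h.inj _ hs' _ ht' h2) h1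
  · change (vertex l m a t).card = _
    rw [vertex, Finset.card_vadd_finset, card_block (h.le _ (Nat.mod_lt t hl).le) (by omega)]

end IsGracefulWalk

end Helpers

/-- For every odd `n` and every `k` with `3 ≤ k < n/3`, the flip graph of
`k`-element subsets of `{1, …, n}` contains a rainbow cycle; it has length
`C(n,2)`. -/
theorem subsets_rainbow_cycle (n k : ℕ) (hodd : Odd n) (hk3 : 3 ≤ k)
    (hkn : 3 * k < n) :
    ∃ V : ℕ → Finset (Fin n), IsRainbowCycleC n k (n.choose 2) V := by
  obtain ⟨l, rfl⟩ := hodd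
  obtain ⟨a, D, h⟩ := exists_isGracefulWalk (l := l) (m := 2 * l + 1 - k) (by omega) (by omega)
    (by omega)
  have hV := h.isRainbowCycleC (by omega) (by omega)
  rw [show 2 * l + 1 - (2 * l + 1 - k) = k by omega] at hV
  exact ⟨_, hV⟩
end
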